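/- arXiv:1103.1330 — 2 statements merged into one kernel-verified Lean document; each statement's English description precedes it below -/
import Mathlib

section
/- Let X, Y be infinite-dimensional Banach spaces, and fix 0 < r < ∞ and 0 < p < q ≤ ∞. Then the operator Lorentz ideal L^{(a)}_{p,r}(X,Y) = {T ∈ B(X,Y) : (a_n(T)) ∈ ℓ_{p,r}} is strictly contained in L^{(a)}_{q,r}(X,Y). -/
/-- `rearr a n` is the `(n+1)`-st term of the non-increasing rearrangement of `(|a m|)`. -/
noncomputable def rearr (a : ℕ → ℝ) (n : ℕ) : ℝ :=
  sInf {t : ℝ | 0 ≤ t ∧ {m : ℕ | t < |a m|}.Finite ∧ Nat.card {m : ℕ | t < |a m|} ≤ n}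

/-- Membership in the Lorentz sequence space `ℓ_{p,r}`, `0 < p ≤ ∞`. -/
noncomputable def MemLorentzE (p : ENNReal) (r : ℝ) (a : ℕ → ℝ) : Prop :=
  (∃ M, ∀ n, |a n| ≤ M) ∧
    if p = ⊤ then BddAbove (Set.range fun n : ℕ => ((n : ℝ) + 1) ^ r * rearr a n)
    else Summable (fun n : ℕ => ((n : ℝ) + 1) ^ (r * p.toReal - 1) * rearr a n ^ p.toReal)

/-- The `n`-th approximation number `a_n(T) = inf{‖T-S‖ : rank S < n}`. -/
noncomputable def approxNum {X Y : Type*} [NormedAddCommGroup X] [NormedSpace ℝ X]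
    [NormedAddCommGroup Y] [NormedSpace ℝ Y] (n : ℕ) (T : X →L[ℝ] Y) : ℝ :=
  sInf {r : ℝ | ∃ S : X →L[ℝ] Y,
    Module.rank ℝ (LinearMap.range (S : X →ₗ[ℝ] Y)) < (n : Cardinal) ∧ r = ‖T - S‖}


namespace LorAux
variable {X Y : Type*} [NormedAddCommGroup X] [NormedSpace ℝ X]
    [NormedAddCommGroup Y] [NormedSpace ℝ Y]

/-- rank at most `n` -/
def RankLE (T : X →L[ℝ] Y) (n : ℕ) : Prop :=
  Module.rank ℝ (LinearMap.range (T : X →ₗ[ℝ] Y)) ≤ (n : Cardinal)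

theorem rankLE_iff (T : X →L[ℝ] Y) (n : ℕ) :
    Module.rank ℝ (LinearMap.range (T : X →ₗ[ℝ] Y)) < ((n + 1 : ℕ) : Cardinal) ↔ RankLE T n := by
  rw [RankLE, ← Order.lt_succ_iff, Cardinal.succ_natCast, Nat.cast_succ]

theorem rankLE_zero (n : ℕ) : RankLE (0 : X →L[ℝ] Y) n := by
  have := LinearMap.rank_zero (K := ℝ) (V := X) (V' := Y)
  unfold LinearMap.rank at this
  simp only [RankLE, ContinuousLinearMap.toLinearMap_zero, this]
  exact zero_le

theorem RankLE.add {S T : X →L[ℝ] Y} {m n : ℕ} (hS : RankLE S m) (hT : RankLE T n) :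
    RankLE (S + T) (m + n) := by
  have := LinearMap.rank_add_le (S : X →ₗ[ℝ] Y) (T : X →ₗ[ℝ] Y)
  unfold LinearMap.rank at this
  unfold RankLE at *
  push_cast
  exact this.trans (add_le_add hS hT)

theorem RankLE.smul {S : X →L[ℝ] Y} {m : ℕ} (hS : RankLE S m) (c : ℝ) : RankLE (c • S) m := by
  unfold RankLE at *
  refine le_trans (Submodule.rank_mono ?_) hS
  rintro _ ⟨x, rfl⟩
  exact ⟨c • x, by simp⟩

theorem RankLE.neg {S : X →L[ℝ] Y} {m : ℕ} (hS : RankLE S m) : RankLE (-S) m := by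
  have := hS.smul (-1)
  simpa using this

theorem RankLE.mono {S : X →L[ℝ] Y} {m n : ℕ} (hS : RankLE S m) (h : m ≤ n) : RankLE S n :=
  le_trans hS (by exact_mod_cast h)

/-- shifted approximation numbers -/
noncomputable def A (T : X →L[ℝ] Y) (k : ℕ) : ℝ := approxNum (k + 1) T

theorem A_nonneg (T : X →L[ℝ] Y) (k : ℕ) : 0 ≤ A T k := by
  unfold A approxNum
  apply Real.sInf_nonneg
  rintro _ ⟨S, _, rfl⟩
  positivity

theorem A_le (T S : X →L[ℝ] Y) (k : ℕ) (hS : RankLE S k) : A T k ≤ ‖T - S‖ := by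
  unfold A approxNum
  apply csInf_le
  · refine ⟨0, ?_⟩
    rintro _ ⟨S, _, rfl⟩
    positivity
  · exact ⟨S, (rankLE_iff S k).2 hS, rfl⟩

theorem A_exists (T : X →L[ℝ] Y) (k : ℕ) {t : ℝ} (ht : A T k < t) :
    ∃ S : X →L[ℝ] Y, RankLE S k ∧ ‖T - S‖ < t := by
  unfold A approxNum at ht
  obtain ⟨_, ⟨S, hS, rfl⟩, h⟩ := exists_lt_of_csInf_lt
    (by exact ⟨‖T - 0‖, 0, (rankLE_iff _ k).2 (rankLE_zero k), rfl⟩) ht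
  exact ⟨S, (rankLE_iff S k).1 hS, h⟩

theorem le_A (T : X →L[ℝ] Y) (k : ℕ) {t : ℝ} (h : ∀ S : X →L[ℝ] Y, RankLE S k → t ≤ ‖T - S‖) :
    t ≤ A T k := by
  by_contra! hc
  obtain ⟨S, hS, h2⟩ := A_exists T k hc
  linarith [h S hS]

theorem A_antitone (T : X →L[ℝ] Y) : Antitone (A T) := fun _ _ hmn =>
  le_A _ _ fun S hS => A_le _ _ _ (hS.mono hmn)

theorem A_le_norm (T : X →L[ℝ] Y) (k : ℕ) : A T k ≤ ‖T‖ := by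
  simpa using A_le T 0 k (rankLE_zero k)

theorem A_add_rank (T U : X →L[ℝ] Y) {R : ℕ} (hU : RankLE U R) (k : ℕ) :
    A (U + T) (k + R) ≤ A T k := by
  refine le_A _ _ fun S hS => ?_
  have := A_le (U + T) (U + S) (k + R) (by rw [add_comm k]; exact hU.add hS)
  simpa using this

theorem A_add_norm (T V : X →L[ℝ] Y) (k : ℕ) : A (T + V) k ≤ A T k + ‖V‖ := by
  rw [← sub_le_iff_le_add]
  refine le_A _ _ fun S hS => ?_
  have := A_le (T + V) S k hS
  have h2 : ‖T + V - S‖ ≤ ‖T - S‖ + ‖V‖ := by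
    rw [add_sub_right_comm]; exact norm_add_le _ _
  linarith

theorem A_eq_zero (T : X →L[ℝ] Y) {R : ℕ} (hT : RankLE T R) {k : ℕ} (hk : R ≤ k) : A T k = 0 := by
  refine le_antisymm ?_ (A_nonneg _ _)
  simpa using A_le T T k (hT.mono hk)

theorem A_smul_le (T : X →L[ℝ] Y) (k : ℕ) {c : ℝ} (hc : 0 < c) : A (c • T) k ≤ c * A T k := by
  rw [← div_le_iff₀' hc]
  refine le_A _ _ fun S hS => ?_
  rw [div_le_iff₀' hc]
  have := A_le (c • T) (c • S) k (hS.smul c)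
  rwa [← smul_sub, norm_smul, Real.norm_of_nonneg hc.le] at this

theorem A_smul (T : X →L[ℝ] Y) (k : ℕ) {c : ℝ} (hc : 0 < c) : A (c • T) k = c * A T k := by
  refine le_antisymm (A_smul_le T k hc) ?_
  have := A_smul_le (c • T) k (inv_pos.2 hc)
  rw [smul_smul, inv_mul_cancel₀ hc.ne', one_smul] at this
  rwa [← div_eq_inv_mul, le_div_iff₀' hc] at this

theorem A_sub_abs (T U : X →L[ℝ] Y) (k : ℕ) : |A T k - A U k| ≤ ‖T - U‖ := by
  rw [abs_le]
  have h1 := A_add_norm U (T - U) k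
  have h2 := A_add_norm T (U - T) k
  rw [add_sub_cancel] at h1 h2
  rw [norm_sub_rev U T] at h2
  constructor <;> linarith

/-- An Auerbach system. -/
theorem auerbach (hX : ¬ FiniteDimensional ℝ X) (D : ℕ) :
    ∃ v : Fin D → X, ∃ f : Fin D → StrongDual ℝ X, (∀ i, ‖v i‖ ≤ 1) ∧ (∀ i, ‖f i‖ ≤ 1) ∧
      ∀ i j, f i (v j) = if j = i then 1 else 0 := by
  classical
  have hrank : (D : Cardinal) ≤ Module.rank ℝ X := by
    by_contra! h
    exact hX (Module.rank_lt_aleph0_iff.1 (h.trans Cardinal.natCast_lt_aleph0))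
  obtain ⟨w, hw⟩ := exists_linearIndependent_of_le_rank hrank
  let E := Submodule.span ℝ (Set.range w)
  let b : Module.Basis (Fin D) ℝ E := Module.Basis.span hw
  have : FiniteDimensional ℝ E := b.finiteDimensional_of_finite
  have hcont : Continuous (fun v : Fin D → E => |b.det v|) := by
    refine continuous_abs.comp ?_
    have hco : ∀ i j, Continuous fun v : Fin D → E => b.coord i (v j) := fun i j =>
      (b.coord i).continuous_of_finiteDimensional.comp (continuous_apply j)
    change Continuous fun v : Fin D → E => (b.toMatrix v).det
    refine Continuous.matrix_det (continuous_matrix fun i j => ?_)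
    exact hco i j
  have hK : IsCompact (Set.pi Set.univ (fun _ : Fin D => Metric.closedBall (0 : E) 1)) :=
    isCompact_univ_pi fun _ => isCompact_closedBall _ _
  obtain ⟨v, hvK, hv⟩ := hK.exists_isMaxOn ⟨fun _ => 0, by simp⟩ hcont.continuousOn
  have hvn : ∀ i, ‖v i‖ ≤ 1 := fun i => by simpa using hvK i (Set.mem_univ i)
  have hpos : b.det v ≠ 0 := by
    have hmem : (fun i => (‖b i‖)⁻¹ • b i) ∈
        Set.pi Set.univ (fun _ : Fin D => Metric.closedBall (0 : E) 1) := by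
      intro i _
      simp only [Metric.mem_closedBall, dist_zero_right, norm_smul, norm_inv, norm_norm]
      exact inv_mul_le_one
    have := hv hmem
    simp only [Set.mem_ofPred_eq] at this
    rw [b.det.map_smul_univ, b.det_self] at this
    intro h0
    rw [h0, abs_zero] at this
    have h3 : (∏ i, ‖b i‖⁻¹) ≠ 0 := by
      apply Finset.prod_ne_zero_iff.2
      intro i _
      exact inv_ne_zero (norm_ne_zero_iff.2 (b.ne_zero i))
    have h4 := abs_pos.2 h3
    simp only [smul_eq_mul, mul_one] at this
    linarith
  let φ : Fin D → (E →ₗ[ℝ] ℝ) := fun i => (b.det v)⁻¹ • b.det.toMultilinearMap.toLinearMap v i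
  have hφ : ∀ i x, φ i x = (b.det v)⁻¹ * b.det (Function.update v i x) := fun i x => rfl
  have hball : ∀ i x, ‖x‖ ≤ 1 → |φ i x| ≤ 1 := by
    intro i x hx
    have hmem : Function.update v i x ∈
        Set.pi Set.univ (fun _ : Fin D => Metric.closedBall (0 : E) 1) := by
      intro j _
      by_cases hj : j = i
      · subst hj; simpa using hx
      · simpa [hj] using hvn j
    have := hv hmem
    simp only [Set.mem_ofPred_eq] at this
    rw [hφ, abs_mul, abs_inv, inv_mul_le_iff₀ (abs_pos.2 hpos), mul_one]
    exact this
  have hbound : ∀ i x, ‖φ i x‖ ≤ 1 * ‖x‖ := by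
    intro i x
    by_cases hx : x = 0
    · subst hx; simp
    · have hx' : 0 < ‖x‖ := norm_pos_iff.2 hx
      have := hball i (‖x‖⁻¹ • x) (by
        rw [norm_smul, norm_inv, norm_norm, inv_mul_cancel₀ hx'.ne'])
      rw [map_smul, smul_eq_mul, abs_mul, abs_inv, abs_norm, inv_mul_le_iff₀ hx'] at this
      rw [Real.norm_eq_abs]; linarith
  have hext : ∀ i, ∃ g : StrongDual ℝ X, (∀ x : E, g x = φ i x) ∧ ‖g‖ ≤ 1 := by
    intro i
    obtain ⟨g, hg, hg2⟩ := exists_extension_norm_eq E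
      ((φ i).mkContinuous 1 (hbound i))
    refine ⟨g, fun x => by rw [hg]; rfl, ?_⟩
    rw [hg2]
    exact LinearMap.mkContinuous_norm_le _ zero_le_one _
  choose f hf hf1 using hext
  refine ⟨fun i => v i, f, fun i => hvn i, hf1, fun i j => ?_⟩
  rw [hf, hφ]
  by_cases hj : j = i
  · subst hj
    simp [hpos]
  · rw [if_neg hj]
    have : b.det (Function.update v i (v j)) = 0 := by
      apply b.det.map_eq_zero_of_eq _ (i := i) (j := j) _ (Ne.symm hj)
      simp [hj]
    rw [this, mul_zero]

/-- Operators of rank `D` with polynomial lower bounds. -/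
theorem exists_poly (hX : ¬ FiniteDimensional ℝ X) (hY : ¬ FiniteDimensional ℝ Y) (D : ℕ) :
    ∃ S : X →L[ℝ] Y, RankLE S D ∧ ‖S‖ ≤ D ∧
      ∀ S' : X →L[ℝ] Y, ∀ m < D, RankLE S' m → 1 ≤ D * ‖S - S'‖ := by
  classical
  obtain ⟨x, f, hx, hf, hfx⟩ := auerbach hX D
  obtain ⟨y, g, hy, hg, hgy⟩ := auerbach hY D
  let S : X →L[ℝ] Y := ∑ i, (f i).smulRight (y i)
  have hSx : ∀ z, S z = ∑ i, f i z • y i := fun z => by simp [S]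
  refine ⟨S, ?_, ?_, ?_⟩
  · unfold RankLE
    have hle : LinearMap.range (S : X →ₗ[ℝ] Y) ≤ Submodule.span ℝ (Set.range y) := by
      rintro _ ⟨z, rfl⟩
      change S z ∈ _
      rw [hSx]
      exact Submodule.sum_mem _ fun i _ => Submodule.smul_mem _ _
        (Submodule.subset_span ⟨i, rfl⟩)
    refine (Submodule.rank_mono hle).trans ((rank_span_le _).trans ?_)
    have h := Cardinal.mk_range_le_lift (f := y)
    simpa using h
  · calc ‖S‖ ≤ ∑ i : Fin D, ‖(f i).smulRight (y i)‖ := norm_sum_le _ _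
      _ ≤ ∑ i : Fin D, (1 : ℝ) := by
        refine Finset.sum_le_sum fun i _ => ?_
        rw [ContinuousLinearMap.norm_smulRight_apply]
        exact mul_le_one₀ (hf i) (norm_nonneg _) (hy i)
      _ = D := by simp
  · intro S' m hm hS'
    let J : (Fin D → ℝ) →ₗ[ℝ] X := Fintype.linearCombination ℝ x
    have hJ : ∀ c, J c = ∑ i, c i • x i := fun c => by
      simp [J, Fintype.linearCombination_apply]
    obtain ⟨c, hc0, hc⟩ : ∃ c : Fin D → ℝ, c ≠ 0 ∧ S' (J c) = 0 := by
      by_contra! hcon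
      have hinj : Function.Injective ((S' : X →ₗ[ℝ] Y) ∘ₗ J) := by
        rw [← LinearMap.ker_eq_bot, LinearMap.ker_eq_bot']
        intro c hc
        by_contra h
        exact hcon c h hc
      have h1 := LinearMap.lift_rank_le_of_injective
        (((S' : X →ₗ[ℝ] Y) ∘ₗ J).codRestrict (LinearMap.range (S' : X →ₗ[ℝ] Y))
          (fun c => ⟨J c, rfl⟩)) (fun a b hab => hinj (congrArg Subtype.val hab))
      have h2 := Cardinal.lift_le.{0}.2 hS'
      simp only [rank_fun', Fintype.card_fin, Cardinal.lift_natCast, Cardinal.lift_uzero] at h1 h2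
      have h3 := h1.trans hS'
      have : D ≤ m := by exact_mod_cast h3
      omega
    have hfc : ∀ i, f i (J c) = c i := by
      intro i; rw [hJ]; simp [hfx]
    have hg2 : ∀ i, |c i| ≤ ‖S - S'‖ * ‖J c‖ := by
      intro i
      have e1 : g i ((S - S') (J c)) = c i := by
        simp only [sub_apply, hc, sub_zero, hSx, hfc]
        simp [hgy]
      rw [← Real.norm_eq_abs, ← e1]
      calc ‖g i ((S - S') (J c))‖ ≤ ‖g i‖ * ‖(S - S') (J c)‖ := (g i).le_opNorm _
        _ ≤ 1 * ‖(S - S') (J c)‖ := by gcongr; exact hg i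
        _ = ‖(S - S') (J c)‖ := one_mul _
        _ ≤ _ := (S - S').le_opNorm _
    have hJc : ‖J c‖ ≤ ∑ i, |c i| := by
      rw [hJ]
      refine (norm_sum_le _ _).trans (Finset.sum_le_sum fun i _ => ?_)
      rw [norm_smul, Real.norm_eq_abs]
      exact mul_le_of_le_one_right (abs_nonneg _) (hx i)
    have hsum : ∑ i, |c i| ≤ D * (‖S - S'‖ * ∑ i, |c i|) := by
      calc ∑ i, |c i| ≤ ∑ i : Fin D, ‖S - S'‖ * ∑ i, |c i| :=
            Finset.sum_le_sum fun i _ => (hg2 i).trans (by gcongr)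
        _ = _ := by simp
    have hpos : 0 < ∑ i, |c i| := by
      obtain ⟨i, hi⟩ := Function.ne_iff.1 hc0
      exact Finset.sum_pos' (fun _ _ => abs_nonneg _) ⟨i, Finset.mem_univ i, abs_pos.2 hi⟩
    by_contra! hlt
    nlinarith

/-- Finite rank operators whose approximation numbers are flat up to `N`. -/
theorem exists_flat (hX : ¬ FiniteDimensional ℝ X) (hY : ¬ FiniteDimensional ℝ Y) (N : ℕ) :
    ∃ S : X →L[ℝ] Y, ∃ R, RankLE S R ∧ 0 < ‖S‖ ∧ ‖S‖ / 4 ≤ A S N := by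
  by_contra! hcon
  have key : ∀ S : X →L[ℝ] Y, (∃ R, RankLE S R) → ∀ j : ℕ, ∃ S' : X →L[ℝ] Y,
      RankLE S' (j * N) ∧ ‖S - S'‖ ≤ (1 / 4) ^ j * ‖S‖ := by
    intro S ⟨R, hR⟩ j
    induction j with
    | zero => exact ⟨0, rankLE_zero _, by simp⟩
    | succ j ih =>
      obtain ⟨S', hS', hn⟩ := ih
      by_cases h0 : 0 < ‖S - S'‖
      · have h1 := hcon (S - S') (R + j * N)
          (by rw [sub_eq_add_neg]; exact hR.add hS'.neg) h0
        obtain ⟨S2, hS2, hlt⟩ := A_exists _ _ h1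
        refine ⟨S' + S2, by rw [Nat.succ_mul]; exact hS'.add hS2, ?_⟩
        rw [← sub_sub, pow_succ]
        linarith
      · refine ⟨S', hS'.mono (by gcongr; omega), ?_⟩
        have : (0:ℝ) ≤ (1 / 4) ^ (j + 1) * ‖S‖ := by positivity
        linarith
  have hlim : Filter.Tendsto (fun j : ℕ => ((N + 1 : ℝ) ^ 2 * 4) * ((j : ℝ) ^ 2 * (1 / 4) ^ j))
      Filter.atTop (nhds (((N + 1 : ℝ) ^ 2 * 4) * 0)) :=
    (tendsto_pow_const_mul_const_pow_of_lt_one 2 (by norm_num) (by norm_num)).const_mul _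
  rw [mul_zero] at hlim
  obtain ⟨j, hj, hj1⟩ := ((hlim.eventually_lt_const zero_lt_one).and
    (Filter.eventually_ge_atTop 1)).exists
  obtain ⟨S, hS, hSn, hS'⟩ := exists_poly hX hY (j * N + 1)
  obtain ⟨S', hr, hn⟩ := key S ⟨_, hS⟩ j
  have h1 := hS' S' (j * N) (by omega) hr
  have hj1' : (1:ℝ) ≤ j := by exact_mod_cast hj1
  push_cast at h1 hSn
  have hD : (j * N + 1 : ℝ) ≤ j * (N + 1) := by nlinarith
  have hN : (0:ℝ) ≤ N := Nat.cast_nonneg _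
  have hp : (0:ℝ) < (1 / 4) ^ j := by positivity
  have : (1:ℝ) ≤ (j * (N + 1)) * ((1 / 4) ^ j * (j * (N + 1))) := by
    refine h1.trans ?_
    refine mul_le_mul hD (hn.trans ?_) (norm_nonneg _) (by positivity)
    gcongr
    exact hSn.trans hD
  nlinarith [sq_nonneg ((N + 1 : ℝ) * j), mul_nonneg hp.le (sq_nonneg ((N + 1 : ℝ) * j))]

theorem rearr_eq {a : ℕ → ℝ} (ha : Antitone a) (h0 : ∀ n, 0 ≤ a n) (n : ℕ) : rearr a n = a n := by
  unfold rearr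
  have hab : ∀ m, |a m| = a m := fun m => abs_of_nonneg (h0 m)
  simp only [hab]
  apply IsLeast.csInf_eq
  constructor
  · have hsub : {m : ℕ | a n < a m} ⊆ (Finset.range n : Set ℕ) := by
      intro m hm
      simp only [Finset.coe_range, Set.mem_Iio]
      by_contra! hc
      exact absurd (ha hc) (not_le.2 hm)
    refine ⟨h0 n, (Finset.finite_toSet _).subset hsub, ?_⟩
    have := Nat.card_mono (Finset.finite_toSet (Finset.range n)) hsub
    simpa using this
  · rintro t ⟨ht, hfin, hcard⟩
    by_contra! hc
    have hsub : (Finset.range (n + 1) : Set ℕ) ⊆ {m : ℕ | t < a m} := by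
      intro m hm
      simp only [Finset.coe_range, Set.mem_Iio] at hm
      exact lt_of_lt_of_le hc (ha (by omega))
    have := Nat.card_mono hfin hsub
    simp only [Nat.card_coe_set_eq, Set.ncard_coe_finset, Finset.card_range] at this hcard
    omega

/-- partial sums of the Lorentz functional -/
noncomputable def P (r s : ℝ) (M : ℕ) (a : ℕ → ℝ) : ℝ :=
  ∑ k ∈ Finset.range M, ((k : ℝ) + 1) ^ (r * s - 1) * a k ^ s

theorem term_nonneg (r s : ℝ) {a : ℕ → ℝ} (h0 : ∀ n, 0 ≤ a n) (k : ℕ) :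
    0 ≤ ((k : ℝ) + 1) ^ (r * s - 1) * a k ^ s :=
  mul_nonneg (by positivity) (Real.rpow_nonneg (h0 k) _)

theorem P_nonneg (r s : ℝ) (M : ℕ) {a : ℕ → ℝ} (h0 : ∀ n, 0 ≤ a n) : 0 ≤ P r s M a :=
  Finset.sum_nonneg fun k _ => term_nonneg r s h0 k

theorem P_mono (r s : ℝ) {a : ℕ → ℝ} (h0 : ∀ n, 0 ≤ a n) : Monotone fun M => P r s M a := by
  intro M N h
  exact Finset.sum_le_sum_of_subset_of_nonneg (Finset.range_mono h)
    fun k _ _ => term_nonneg r s h0 k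

theorem P_stable (r : ℝ) {s : ℝ} (hs : 0 < s) {a : ℕ → ℝ} {R M : ℕ} (hRM : R ≤ M)
    (h : ∀ k, R ≤ k → a k = 0) : P r s M a = P r s R a := by
  unfold P
  symm
  refine Finset.sum_subset (Finset.range_mono hRM) fun k _ hk => ?_
  rw [h k (by simpa using hk), Real.zero_rpow hs.ne', mul_zero]

theorem weight_double {x y α : ℝ} (hx : 0 < x) (hxy : x ≤ y) (hy : y ≤ 2 * x) (hα : 0 < α) :
    y ^ (α - 1) ≤ 2 ^ α * x ^ (α - 1) := by
  have hy0 : 0 < y := hx.trans_le hxy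
  rw [Real.rpow_sub_one hx.ne', Real.rpow_sub_one hy0.ne', ← mul_div_assoc,
    ← Real.mul_rpow (by norm_num) hx.le]
  gcongr

theorem weight_sum {α : ℝ} (hα : 0 < α) (n : ℕ) :
    ((n : ℝ) + 1) ^ α ≤ 2 ^ (α + 1) * ∑ k ∈ Finset.range (n + 1), ((k : ℝ) + 1) ^ (α - 1) := by
  have hn : (0:ℝ) < (n : ℝ) + 1 := by positivity
  have h1 : ∑ k ∈ Finset.Ico ((n + 1) / 2) (n + 1), (((n : ℝ) + 1) / 2) ^ α / ((n : ℝ) + 1) ≤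
      ∑ k ∈ Finset.range (n + 1), ((k : ℝ) + 1) ^ (α - 1) := by
    refine le_trans (Finset.sum_le_sum (g := fun k : ℕ => ((k : ℝ) + 1) ^ (α - 1)) ?_)
      (Finset.sum_le_sum_of_subset_of_nonneg ?_ ?_)
    · intro k hk
      rw [Finset.mem_Ico] at hk
      have hk1 : n + 1 ≤ 2 * (k + 1) := by omega
      have hk1' : (n : ℝ) + 1 ≤ 2 * ((k : ℝ) + 1) := by exact_mod_cast hk1
      have hk2 : k + 1 ≤ n + 1 := by omega
      have hk2' : (k : ℝ) + 1 ≤ n + 1 := by exact_mod_cast hk2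
      have hk0 : (0:ℝ) < (k : ℝ) + 1 := by positivity
      rw [Real.rpow_sub_one hk0.ne']
      gcongr
      linarith
    · intro k hk
      rw [Finset.mem_Ico] at hk
      simpa using hk.2
    · intro k _ _
      positivity
  rw [Finset.sum_const, Nat.card_Ico, nsmul_eq_mul, Real.div_rpow hn.le (by norm_num)] at h1
  have hc : ((n : ℝ) + 1) / 2 ≤ ((n + 1 - (n + 1) / 2 : ℕ) : ℝ) := by
    rw [div_le_iff₀ (by norm_num)]
    have : n + 1 ≤ (n + 1 - (n + 1) / 2) * 2 := by omega
    exact_mod_cast this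
  have h2 : ((n : ℝ) + 1) / 2 * (((n : ℝ) + 1) ^ α / 2 ^ α / ((n : ℝ) + 1)) ≤
      ∑ k ∈ Finset.range (n + 1), ((k : ℝ) + 1) ^ (α - 1) :=
    le_trans (by gcongr) h1
  have h3 : ((n : ℝ) + 1) / 2 * (((n : ℝ) + 1) ^ α / 2 ^ α / ((n : ℝ) + 1)) =
      ((n : ℝ) + 1) ^ α / 2 ^ (α + 1) := by
    rw [Real.rpow_add_one (by norm_num)]
    field_simp
  rw [h3, div_le_iff₀' (by positivity)] at h2
  exact h2

theorem I1 {r s : ℝ} (hr : 0 < r) (hs : 0 < s) {a : ℕ → ℝ} (ha : Antitone a)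
    (h0 : ∀ n, 0 ≤ a n) (n : ℕ) :
    (((n : ℝ) + 1) ^ r * a n) ^ s ≤ 2 ^ (r * s + 1) * P r s (n + 1) a := by
  have hn : (0:ℝ) ≤ (n : ℝ) + 1 := by positivity
  rw [Real.mul_rpow (by positivity) (h0 n), ← Real.rpow_mul hn]
  calc ((n : ℝ) + 1) ^ (r * s) * a n ^ s
      ≤ (2 ^ (r * s + 1) * ∑ k ∈ Finset.range (n + 1), ((k : ℝ) + 1) ^ (r * s - 1)) * a n ^ s :=
        mul_le_mul_of_nonneg_right (weight_sum (mul_pos hr hs) n) (Real.rpow_nonneg (h0 n) _)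
    _ = 2 ^ (r * s + 1) * ∑ k ∈ Finset.range (n + 1), ((k : ℝ) + 1) ^ (r * s - 1) * a n ^ s := by
        rw [mul_assoc, Finset.sum_mul]
    _ ≤ _ := by
        unfold P
        refine mul_le_mul_of_nonneg_left (Finset.sum_le_sum fun k hk => ?_) (by positivity)
        have hk' : k ≤ n := by simpa [Nat.lt_succ_iff] using hk
        exact mul_le_mul_of_nonneg_left (Real.rpow_le_rpow (h0 n) (ha hk') hs.le) (by positivity)

theorem I2 {r p q : ℝ} (hr : 0 < r) (hp : 0 < p) (hpq : p < q) {a : ℕ → ℝ} (ha : Antitone a)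
    (h0 : ∀ n, 0 ≤ a n) (M : ℕ) :
    P r q M a ≤ (2 ^ (r * p + 1) * P r p M a) ^ (q / p) := by
  set C : ℝ := 2 ^ (r * p + 1) with hC
  have hC1 : 1 ≤ C := Real.one_le_rpow (by norm_num) (by positivity)
  have hP : 0 ≤ P r p M a := P_nonneg r p M h0
  have hk : ∀ k ∈ Finset.range M, ((k : ℝ) + 1) ^ (r * q - 1) * a k ^ q ≤
      ((k : ℝ) + 1) ^ (r * p - 1) * a k ^ p * (C * P r p M a) ^ ((q - p) / p) := by
    intro k hk
    have hk0 : (0:ℝ) < (k : ℝ) + 1 := by positivity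
    have e1 : ((k : ℝ) + 1) ^ (r * q - 1) * a k ^ q =
        ((k : ℝ) + 1) ^ (r * p - 1) * a k ^ p * ((((k : ℝ) + 1) ^ r * a k) ^ p) ^ ((q - p) / p) := by
      rw [← Real.rpow_mul (mul_nonneg (by positivity) (h0 k)), mul_div_cancel₀ _ hp.ne',
        Real.mul_rpow (by positivity) (h0 k), ← Real.rpow_mul hk0.le, mul_mul_mul_comm,
        ← Real.rpow_add hk0, ← Real.rpow_add_of_nonneg (h0 k) hp.le (by linarith)]
      congr 2 <;> ring
    rw [e1]
    refine mul_le_mul_of_nonneg_left ?_ (term_nonneg r p h0 k)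
    refine Real.rpow_le_rpow (Real.rpow_nonneg (mul_nonneg (by positivity) (h0 k)) _) ?_
      (div_nonneg (by linarith) hp.le)
    refine (I1 hr hp ha h0 k).trans ?_
    refine mul_le_mul_of_nonneg_left (P_mono r p h0 ?_) (by positivity)
    have := Finset.mem_range.1 hk
    omega
  calc P r q M a ≤ P r p M a * (C * P r p M a) ^ ((q - p) / p) := by
        have := Finset.sum_le_sum hk
        rw [← Finset.sum_mul] at this
        exact this
    _ ≤ (C * P r p M a) * (C * P r p M a) ^ ((q - p) / p) := by
        refine mul_le_mul_of_nonneg_right ?_ (by positivity)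
        nlinarith
    _ = (C * P r p M a) ^ (1 + (q - p) / p) := by
        rw [Real.rpow_add_of_nonneg (by positivity) zero_le_one
          (div_nonneg (by linarith) hp.le), Real.rpow_one]
    _ = _ := by
        congr 1
        field_simp
        ring

theorem P_cont {r s : ℝ} (hs : 0 < s) (M : ℕ) :
    Continuous fun T : X →L[ℝ] Y => P r s M (A T) := by
  have hA : ∀ k, Continuous fun T : X →L[ℝ] Y => A T k := by
    intro k
    refine (LipschitzWith.of_dist_le_mul (K := 1) fun T U => ?_).continuous
    rw [Real.dist_eq, dist_eq_norm, NNReal.coe_one, one_mul]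
    exact A_sub_abs T U k
  unfold P
  exact continuous_finsetSum _ fun k _ =>
    continuous_const.mul ((hA k).rpow_const fun _ => Or.inr hs.le)

theorem P_cont' {r s : ℝ} (hs : 0 < s) (M : ℕ) (U : X →L[ℝ] Y) {η : ℝ} (hη : 0 < η) :
    ∃ δ > 0, ∀ T : X →L[ℝ] Y, ‖T - U‖ ≤ δ → |P r s M (A T) - P r s M (A U)| ≤ η := by
  obtain ⟨δ, hδ, h⟩ := Metric.continuous_iff.1 (P_cont (X := X) (Y := Y) (r := r) hs M) U η hη
  refine ⟨δ / 2, by positivity, fun T hT => ?_⟩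
  have := h T (by rw [dist_eq_norm]; linarith)
  rw [Real.dist_eq] at this
  exact this.le

theorem exists_V (hX : ¬ FiniteDimensional ℝ X) (hY : ¬ FiniteDimensional ℝ Y)
    {r q : ℝ} (hr : 0 < r) (hq : 0 < q) {β δ : ℝ} (hβ : 0 < β) (hδ : 0 < δ) :
    ∃ V : X →L[ℝ] Y, ∃ R, RankLE V R ∧ ‖V‖ ≤ δ ∧ P r q R (A V) = β ^ q := by
  have hlim : Filter.Tendsto (fun N : ℕ => ((N : ℝ) + 1) ^ r) Filter.atTop Filter.atTop :=
    (tendsto_rpow_atTop hr).comp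
      (Filter.tendsto_atTop_add_const_right _ _ tendsto_natCast_atTop_atTop)
  obtain ⟨N, hN⟩ := (hlim.eventually_ge_atTop
    (β * 4 * ((2:ℝ) ^ (r * q + 1)) ^ (1 / q) / δ)).exists
  obtain ⟨S, R0, hS0, hSpos, hSA⟩ := exists_flat hX hY N
  obtain ⟨R, hRN, hS⟩ : ∃ R, N + 1 ≤ R ∧ RankLE S R :=
    ⟨R0 + (N + 1), by omega, hS0.mono (by omega)⟩
  have hApos : 0 < A S N := lt_of_lt_of_le (by positivity) hSA
  have h1 := (I1 hr hq (A_antitone S) (A_nonneg S) N).trans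
    (mul_le_mul_of_nonneg_left (P_mono r q (A_nonneg S) hRN) (by positivity))
  simp only at h1
  set Q := P r q R (A S) with hQ
  set C : ℝ := 2 ^ (r * q + 1) with hC
  have hCpos : 0 < C := by positivity
  have hQ0 : 0 ≤ Q := P_nonneg _ _ _ (A_nonneg S)
  have hQpos : 0 < Q := by
    have : 0 < (((N : ℝ) + 1) ^ r * A S N) ^ q := by positivity
    by_contra! h
    nlinarith
  have h2 : ((N : ℝ) + 1) ^ r * A S N ≤ C ^ (1 / q) * Q ^ (1 / q) := by
    rw [← Real.mul_rpow hCpos.le hQ0]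
    have := Real.rpow_le_rpow (by positivity) h1 (by positivity : 0 ≤ 1 / q)
    rwa [← Real.rpow_mul (by positivity), mul_one_div_cancel hq.ne', Real.rpow_one] at this
  set z := Q ^ (1 / q) with hz
  have hzpos : 0 < z := by positivity
  have hzq : z ^ q = Q := by
    rw [hz, ← Real.rpow_mul hQ0, one_div_mul_cancel hq.ne', Real.rpow_one]
  have hcpos : 0 < β / z := by positivity
  refine ⟨(β / z) • S, R, hS.smul _, ?_, ?_⟩
  · rw [norm_smul, Real.norm_of_nonneg hcpos.le, div_mul_eq_mul_div, div_le_iff₀ hzpos]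
    rw [div_le_iff₀ hδ] at hN
    have hw : 0 < ((N : ℝ) + 1) ^ r := by positivity
    set w := ((N : ℝ) + 1) ^ r
    set c := C ^ (1 / q)
    have hcp : 0 < c := by positivity
    have h3 : w * ‖S‖ ≤ 4 * (c * z) := by nlinarith
    have h4 : w * (β * ‖S‖) ≤ w * (δ * z) := by
      calc w * (β * ‖S‖) = β * (w * ‖S‖) := by ring
        _ ≤ β * (4 * (c * z)) := by gcongr
        _ = (β * 4 * c) * z := by ring
        _ ≤ (w * δ) * z := by gcongr
        _ = _ := by ring
    exact le_of_mul_le_mul_left h4 hw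
  · have : P r q R (A ((β / z) • S)) = (β / z) ^ q * Q := by
      rw [hQ]
      unfold P
      rw [Finset.mul_sum]
      refine Finset.sum_congr rfl fun k _ => ?_
      rw [A_smul _ _ hcpos, Real.mul_rpow hcpos.le (A_nonneg _ _)]
      ring
    rw [this, Real.div_rpow hβ.le hzpos.le, hzq]
    field_simp

theorem step (hX : ¬ FiniteDimensional ℝ X) (hY : ¬ FiniteDimensional ℝ Y)
    {r p q : ℝ} (hr : 0 < r) (hp : 0 < p) (hpq : p < q) :
    ∃ c > 0, ∃ C : ℝ, 0 < C ∧ ∀ β : ℝ, 0 < β → ∀ U : X →L[ℝ] Y, ∀ R : ℕ, RankLE U R → ∀ δ : ℝ, 0 < δ →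
      ∃ U' : X →L[ℝ] Y, ∃ R' : ℕ, RankLE U' R' ∧ ‖U' - U‖ ≤ δ ∧
        P r q R' (A U') ≤ P r q R (A U) + C * β ^ q ∧
        P r p R (A U) + c * β ^ p ≤ P r p R' (A U') := by
  have hq : 0 < q := hp.trans hpq
  set K : ℝ := 2 ^ (r * p + 1) with hK
  set d : ℝ := 2 ^ (r * p) with hd
  have hKpos : 0 < K := by positivity
  have hd1 : 1 ≤ d := Real.one_le_rpow (by norm_num) (by positivity)
  refine ⟨1 / (2 * K * d), by positivity, 2 ^ (r * q) + 1, by positivity, ?_⟩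
  intro β hβ U R hU δ hδ
  have hβp : 0 < β ^ p := by positivity
  set c : ℝ := 1 / (2 * K * d) with hc
  have hcpos : 0 < c := by positivity
  have he : 0 < c * β ^ p / 2 := by positivity
  set e : ℝ := c * β ^ p / 2 with hedef
  obtain ⟨δ1, hδ1, H1⟩ := P_cont' (r := r) hq (2 * R) U (show 0 < β ^ q by positivity)
  obtain ⟨δ2, hδ2, H2⟩ := P_cont' (r := r) hp (2 * R) U he
  obtain ⟨δ3, hδ3, H3⟩ := P_cont' (r := r) hp (3 * R) (0 : X →L[ℝ] Y) he
  obtain ⟨V, RV, hV, hVn, hVQ⟩ := exists_V hX hY hr hq hβ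
    (show 0 < min (min δ δ1) (min δ2 δ3) by positivity)
  simp only [le_min_iff] at hVn
  obtain ⟨⟨hVδ, hV1⟩, hV2, hV3⟩ := hVn
  have hUV : (U + V) - U = V := by abel
  have hVp : β ^ p ≤ K * P r p RV (A V) := by
    have := I2 hr hp hpq (A_antitone V) (A_nonneg V) RV
    rw [hVQ] at this
    have h2 := Real.rpow_le_rpow (by positivity) this (show 0 ≤ p / q by positivity)
    rw [← Real.rpow_mul hβ.le, ← Real.rpow_mul (mul_nonneg hKpos.le (P_nonneg _ _ _ (A_nonneg V)))]
      at h2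
    have e1 : q * (p / q) = p := by field_simp
    have e2 : q / p * (p / q) = 1 := by field_simp
    rwa [e1, e2, Real.rpow_one] at h2
  have hsplit : ∀ (s : ℝ) (a : ℕ → ℝ) (m n : ℕ), P r s (m + n) a = P r s m a +
      ∑ j ∈ Finset.range n, (((m + j : ℕ) : ℝ) + 1) ^ (r * s - 1) * a (m + j) ^ s := by
    intro s a m n
    unfold P
    rw [Finset.sum_range_add]
  have hUz : ∀ k, R ≤ k → A U k = 0 := fun k hk => A_eq_zero U hU hk
  have hVz : ∀ k, RV ≤ k → A V k = 0 := fun k hk => A_eq_zero V hV hk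
  refine ⟨U + V, 2 * R + RV, (hU.add hV).mono (by omega), by rwa [hUV], ?_, ?_⟩
  · have h1 := H1 (U + V) (by rwa [hUV])
    rw [abs_le] at h1
    rw [P_stable r hq (show R ≤ 2 * R by omega) hUz] at h1
    rw [hsplit]
    have h2 : ∑ j ∈ Finset.range RV, (((2 * R + j : ℕ) : ℝ) + 1) ^ (r * q - 1) *
        A (U + V) (2 * R + j) ^ q ≤ 2 ^ (r * q) * β ^ q := by
      have h3 : P r q (R + RV) (A V) = β ^ q := by
        rw [P_stable r hq (show RV ≤ R + RV by omega) hVz, hVQ]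
      rw [hsplit] at h3
      have h4 : ∑ j ∈ Finset.range RV, (((R + j : ℕ) : ℝ) + 1) ^ (r * q - 1) *
          A V (R + j) ^ q ≤ β ^ q := by
        have := P_nonneg r q R (A_nonneg V)
        linarith
      refine le_trans ?_ (mul_le_mul_of_nonneg_left h4 (by positivity))
      rw [Finset.mul_sum]
      refine Finset.sum_le_sum fun j _ => ?_
      rw [← mul_assoc]
      refine mul_le_mul ?_ ?_ (Real.rpow_nonneg (A_nonneg _ _) _) (by positivity)
      · apply weight_double _ _ _ (by positivity)
        · positivity
        · push_cast; linarith [(Nat.cast_nonneg R : (0:ℝ) ≤ R)]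
        · push_cast; linarith [(Nat.cast_nonneg j : (0:ℝ) ≤ j)]
      · refine Real.rpow_le_rpow (A_nonneg _ _) ?_ hq.le
        have := A_add_rank V U hU (R + j)
        rwa [show R + j + R = 2 * R + j by ring] at this
    linarith [h1.2]
  · have h1 := H2 (U + V) (by rwa [hUV])
    rw [abs_le] at h1
    rw [P_stable r hp (show R ≤ 2 * R by omega) hUz] at h1
    have h5 := H3 V (by simpa using hV3)
    have hz0 : P r p (3 * R) (A (0 : X →L[ℝ] Y)) = 0 := by
      rw [P_stable r hp (Nat.zero_le _) (fun k hk => A_eq_zero 0 (rankLE_zero 0) hk)]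
      simp [P]
    rw [hz0, sub_zero, abs_le] at h5
    rw [hsplit]
    have h2 : P r p RV (A V) - e ≤ d * ∑ j ∈ Finset.range RV,
        (((2 * R + j : ℕ) : ℝ) + 1) ^ (r * p - 1) * A (U + V) (2 * R + j) ^ p := by
      have h3 : P r p (3 * R + RV) (A V) = P r p RV (A V) :=
        P_stable r hp (show RV ≤ 3 * R + RV by omega) hVz
      rw [hsplit] at h3
      have h4 : P r p RV (A V) - e ≤ ∑ j ∈ Finset.range RV,
          (((3 * R + j : ℕ) : ℝ) + 1) ^ (r * p - 1) * A V (3 * R + j) ^ p := by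
        linarith [h5.2]
      refine h4.trans ?_
      rw [Finset.mul_sum]
      refine Finset.sum_le_sum fun j _ => ?_
      rw [← mul_assoc]
      refine mul_le_mul ?_ ?_ (Real.rpow_nonneg (A_nonneg _ _) _) (by positivity)
      · apply weight_double _ _ _ (by positivity)
        · positivity
        · push_cast; linarith [(Nat.cast_nonneg R : (0:ℝ) ≤ R)]
        · push_cast; linarith [(Nat.cast_nonneg j : (0:ℝ) ≤ j), (Nat.cast_nonneg R : (0:ℝ) ≤ R)]
      · refine Real.rpow_le_rpow (A_nonneg _ _) ?_ hp.le
        have := A_add_rank (U + V) (-U) hU.neg (2 * R + j)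
        rwa [show 2 * R + j + R = 3 * R + j by ring, neg_add_cancel_left] at this
    set Sg := ∑ j ∈ Finset.range RV,
        (((2 * R + j : ℕ) : ℝ) + 1) ^ (r * p - 1) * A (U + V) (2 * R + j) ^ p
    have h6 : 2 * (c * β ^ p) * d ≤ P r p RV (A V) := by
      have : 2 * (c * β ^ p) * d = β ^ p / K := by
        rw [hc]; field_simp
      rw [this, div_le_iff₀ hKpos]
      linarith
    have h7 : 2 * (c * β ^ p) - e ≤ Sg := by
      have : (2 * (c * β ^ p) - e) * d ≤ d * Sg := by nlinarith
      rw [mul_comm d] at this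
      exact le_of_mul_le_mul_right this (by linarith)
    linarith [h1.1]

theorem exists_T [CompleteSpace Y] (hX : ¬ FiniteDimensional ℝ X) (hY : ¬ FiniteDimensional ℝ Y)
    {r p q : ℝ} (hr : 0 < r) (hp : 0 < p) (hpq : p < q) :
    ∃ T : X →L[ℝ] Y, (∃ B, ∀ M, P r q M (A T) ≤ B) ∧ ∀ B, ∃ M, B < P r p M (A T) := by
  have hq : 0 < q := hp.trans hpq
  obtain ⟨c, hc, C, hC, H⟩ := step hX hY hr hp hpq
  let β : ℕ → ℝ := fun i => ((i : ℝ) + 1) ^ (-(1 / p))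
  have hβ : ∀ i, 0 < β i := fun i => by positivity
  have hβp : ∀ i, β i ^ p = 1 / ((i : ℝ) + 1) := fun i => by
    simp only [β]
    rw [← Real.rpow_mul (by positivity), neg_mul, one_div_mul_cancel hp.ne', Real.rpow_neg_one,
      one_div]
  have hβq : Summable fun i => β i ^ q := by
    have h1 : Summable fun n : ℕ => ((n : ℝ)) ^ (-(q / p)) := by
      rw [Real.summable_nat_rpow]
      have : 1 < q / p := by rwa [one_lt_div hp]
      linarith
    have h2 := (summable_nat_add_iff 1).2 h1
    refine h2.congr fun i => ?_
    simp only [β]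
    rw [← Real.rpow_mul (by positivity)]
    push_cast
    congr 1
    field_simp
  let St := {x : (X →L[ℝ] Y) × ℕ × ℝ // RankLE x.1 x.2.1 ∧ 0 < x.2.2 ∧
    ∀ T : X →L[ℝ] Y, ‖T - x.1‖ ≤ x.2.2 → P r p x.2.1 (A x.1) - 1 ≤ P r p x.2.1 (A T)}
  have hnext : ∀ (i : ℕ) (x : St), ∃ y : St, ‖y.1.1 - x.1.1‖ ≤ x.1.2.2 / 2 ∧
      y.1.2.2 ≤ x.1.2.2 / 2 ∧
      P r q y.1.2.1 (A y.1.1) ≤ P r q x.1.2.1 (A x.1.1) + C * β i ^ q ∧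
      P r p x.1.2.1 (A x.1.1) + c * β i ^ p ≤ P r p y.1.2.1 (A y.1.1) := by
    rintro i ⟨⟨U, R, δ⟩, hU, hδ, -⟩
    simp only at hU hδ ⊢
    obtain ⟨U', R', hU', hn, h1, h2⟩ := H (β i) (hβ i) U R hU (δ / 2) (by positivity)
    obtain ⟨δ', hδ', hc'⟩ := P_cont' (r := r) hp R' U' (zero_lt_one)
    refine ⟨⟨⟨U', R', min δ' (δ / 2)⟩, hU', by simp only; positivity, fun T hT => ?_⟩,
      hn, min_le_right _ _, h1, h2⟩
    have := hc' T (hT.trans (min_le_left _ _))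
    rw [abs_le] at this
    simp only
    linarith [this.1]
  choose next hn1 hn2 hn3 hn4 using hnext
  let x0 : St := ⟨⟨0, 0, 1⟩, rankLE_zero 0, zero_lt_one, fun T _ => by simp [P]⟩
  let x : ℕ → St := fun n => Nat.rec x0 (fun i y => next i y) n
  have hx : ∀ i, x (i + 1) = next i (x i) := fun i => rfl
  let U : ℕ → (X →L[ℝ] Y) := fun i => (x i).1.1
  let R : ℕ → ℕ := fun i => (x i).1.2.1
  let δ : ℕ → ℝ := fun i => (x i).1.2.2
  have k1 : ∀ i, ‖U (i + 1) - U i‖ ≤ δ i / 2 := fun i => hn1 i (x i)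
  have k2 : ∀ i, δ (i + 1) ≤ δ i / 2 := fun i => hn2 i (x i)
  have k3 : ∀ i, P r q (R (i + 1)) (A (U (i + 1))) ≤ P r q (R i) (A (U i)) + C * β i ^ q :=
    fun i => hn3 i (x i)
  have k4 : ∀ i, P r p (R i) (A (U i)) + c * β i ^ p ≤ P r p (R (i + 1)) (A (U (i + 1))) :=
    fun i => hn4 i (x i)
  have k5 : ∀ i, RankLE (U i) (R i) := fun i => (x i).2.1
  have k6 : ∀ i, ∀ T : X →L[ℝ] Y, ‖T - U i‖ ≤ δ i →
      P r p (R i) (A (U i)) - 1 ≤ P r p (R i) (A T) := fun i => (x i).2.2.2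
  have hUR0 : ∀ s, P r s (R 0) (A (U 0)) = 0 := fun s => by
    change P r s 0 _ = 0
    simp [P]
  clear_value U R δ
  have hδ : ∀ i, δ i ≤ δ 0 / 2 ^ i := by
    intro i
    induction i with
    | zero => simp
    | succ i ih =>
      refine (k2 i).trans ?_
      rw [pow_succ, ← div_div]
      gcongr
  have hball : ∀ i j, ‖U (i + j) - U i‖ ≤ δ i - δ (i + j) := by
    intro i j
    induction j with
    | zero => simp
    | succ j ih =>
      have h1 := k1 (i + j)
      have h2 := k2 (i + j)
      have h3 : ‖U (i + (j + 1)) - U i‖ ≤ ‖U (i + j + 1) - U (i + j)‖ + ‖U (i + j) - U i‖ := by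
        rw [← add_assoc]
        exact norm_sub_le_norm_sub_add_norm_sub _ _ _
      rw [← add_assoc] at *
      linarith
  have hδ0 : ∀ i, 0 ≤ δ i := fun i => by
    have := (norm_nonneg _).trans (k1 i)
    linarith
  have hcau : CauchySeq U := by
    refine cauchySeq_of_le_geometric_two (C := δ 0) fun n => ?_
    rw [dist_comm, dist_eq_norm]
    refine (k1 n).trans ?_
    have := hδ n
    rw [div_div, mul_comm, ← div_div]
    linarith
  obtain ⟨T, hT⟩ := cauchySeq_tendsto_of_complete hcau
  have hTb : ∀ i, ‖T - U i‖ ≤ δ i := by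
    intro i
    refine le_of_tendsto ((hT.sub_const (U i)).norm) ?_
    filter_upwards [Filter.eventually_ge_atTop i] with j hj
    obtain ⟨m, rfl⟩ := Nat.exists_eq_add_of_le hj
    have := hball i m
    linarith [hδ0 (i + m)]
  have hqs : ∀ i, P r q (R i) (A (U i)) ≤ C * ∑ j ∈ Finset.range i, β j ^ q := by
    intro i
    induction i with
    | zero => simp [hUR0]
    | succ i ih =>
      rw [Finset.sum_range_succ, mul_add]
      linarith [k3 i]
  have hps : ∀ i, c * ∑ j ∈ Finset.range i, β j ^ p ≤ P r p (R i) (A (U i)) := by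
    intro i
    induction i with
    | zero => simp [hUR0]
    | succ i ih =>
      rw [Finset.sum_range_succ, mul_add]
      linarith [k4 i]
  refine ⟨T, ⟨C * ∑' j, β j ^ q, fun M => ?_⟩, fun B => ?_⟩
  · refine le_of_tendsto (((P_cont (r := r) hq M).tendsto T).comp hT) (Filter.Eventually.of_forall ?_)
    intro i
    have h1 : P r q M (A (U i)) ≤ P r q (R i) (A (U i)) := by
      rcases le_total M (R i) with h | h
      · exact P_mono r q (A_nonneg _) h
      · exact (P_stable r hq h fun k hk => A_eq_zero _ (k5 i) hk).le
    refine h1.trans ((hqs i).trans ?_)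
    exact mul_le_mul_of_nonneg_left
      (hβq.sum_le_tsum _ fun j _ => (Real.rpow_nonneg (hβ j).le _)) hC.le
  · have hdiv := Real.tendsto_sum_range_one_div_nat_succ_atTop
    obtain ⟨i, hi⟩ := (hdiv.eventually_gt_atTop ((B + 1) / c)).exists
    refine ⟨R i, ?_⟩
    have h1 := k6 i T (hTb i)
    have h2 := hps i
    simp only [hβp] at h2
    rw [div_lt_iff₀' hc] at hi
    linarith

end LorAux

open LorAux

theorem stmt_12 {X Y : Type*} [NormedAddCommGroup X] [NormedSpace ℝ X] [CompleteSpace X]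
    [NormedAddCommGroup Y] [NormedSpace ℝ Y] [CompleteSpace Y]
    (hX : ¬ FiniteDimensional ℝ X) (hY : ¬ FiniteDimensional ℝ Y)
    (r : ℝ) (hr : 0 < r) (p q : ENNReal) (hp : 0 < p) (hpq : p < q) :
    {T : X →L[ℝ] Y | MemLorentzE p r (fun n => approxNum (n + 1) T)}
      ⊂ {T : X →L[ℝ] Y | MemLorentzE q r (fun n => approxNum (n + 1) T)} := by
  have hsub : ∀ p q' : ENNReal, 0 < p → p < q' → ∀ T : X →L[ℝ] Y,
      MemLorentzE p r (fun n => approxNum (n + 1) T) →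
      MemLorentzE q' r (fun n => approxNum (n + 1) T) := by
    intro p q' hp hpq' T ⟨hb, h⟩
    have hpt : p ≠ ⊤ := hpq'.ne_top
    have hp0 : 0 < p.toReal := ENNReal.toReal_pos hp.ne' hpt
    rw [if_neg hpt] at h
    refine ⟨hb, ?_⟩
    change Summable (fun n : ℕ => ((n : ℝ) + 1) ^ (r * p.toReal - 1) * rearr (A T) n ^ p.toReal) at h
    simp only [rearr_eq (A_antitone T) (A_nonneg T)] at h
    have hPb : ∀ M, P r p.toReal M (A T) ≤
        ∑' n : ℕ, ((n : ℝ) + 1) ^ (r * p.toReal - 1) * A T n ^ p.toReal := fun M =>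
      h.sum_le_tsum _ fun n _ => term_nonneg _ _ (A_nonneg T) n
    set B := ∑' n : ℕ, ((n : ℝ) + 1) ^ (r * p.toReal - 1) * A T n ^ p.toReal
    split_ifs with hq
    · refine ⟨(2 ^ (r * p.toReal + 1) * B) ^ (1 / p.toReal), ?_⟩
      rintro _ ⟨n, rfl⟩
      change ((n : ℝ) + 1) ^ r * rearr (A T) n ≤ _
      rw [rearr_eq (A_antitone T) (A_nonneg T)]
      have h1 := (I1 hr hp0 (A_antitone T) (A_nonneg T) n).trans
        (mul_le_mul_of_nonneg_left (hPb _) (by positivity))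
      have h0 : 0 ≤ ((n : ℝ) + 1) ^ r * A T n := mul_nonneg (by positivity) (A_nonneg T n)
      have h2 := Real.rpow_le_rpow (Real.rpow_nonneg h0 _) h1
        (show 0 ≤ 1 / p.toReal by positivity)
      rwa [← Real.rpow_mul h0, mul_one_div_cancel hp0.ne', Real.rpow_one] at h2
    · change Summable (fun n : ℕ => ((n : ℝ) + 1) ^ (r * q'.toReal - 1) *
        rearr (A T) n ^ q'.toReal)
      simp only [rearr_eq (A_antitone T) (A_nonneg T)]
      have hpq2 : p.toReal < q'.toReal := (ENNReal.toReal_lt_toReal hpt hq).2 hpq'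
      refine summable_of_sum_range_le (c := (2 ^ (r * p.toReal + 1) * B) ^ (q'.toReal / p.toReal))
        (fun n => term_nonneg _ _ (A_nonneg T) n) fun M => ?_
      refine (I2 hr hp0 hpq2 (A_antitone T) (A_nonneg T) M).trans ?_
      refine Real.rpow_le_rpow (mul_nonneg (by positivity) (P_nonneg _ _ _ (A_nonneg T))) ?_
        (by positivity)
      exact mul_le_mul_of_nonneg_left (hPb M) (by positivity)
  have hpt : p ≠ ⊤ := hpq.ne_top
  have hp0 : 0 < p.toReal := ENNReal.toReal_pos hp.ne' hpt
  refine (Set.ssubset_iff_of_subset (fun T hT => hsub p q hp hpq T hT)).2 ?_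
  obtain ⟨s, hps, hsq⟩ := exists_between hpq
  have hst : s ≠ ⊤ := hsq.ne_top
  have hps2 : p.toReal < s.toReal := (ENNReal.toReal_lt_toReal hpt hst).2 hps
  have hs0 : 0 < s := hp.trans hps
  obtain ⟨T, ⟨B, hB⟩, hu⟩ := exists_T hX hY hr hp0 hps2
  refine ⟨T, hsub s q hs0 hsq T ⟨⟨‖T‖, fun n => ?_⟩, ?_⟩, ?_⟩
  · change |A T n| ≤ ‖T‖
    rw [abs_of_nonneg (A_nonneg T n)]
    exact A_le_norm T n
  · rw [if_neg hst]
    change Summable (fun n : ℕ => ((n : ℝ) + 1) ^ (r * s.toReal - 1) * rearr (A T) n ^ s.toReal)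
    simp only [rearr_eq (A_antitone T) (A_nonneg T)]
    exact summable_of_sum_range_le (fun n => term_nonneg _ _ (A_nonneg T) n) hB
  · rintro ⟨-, h⟩
    rw [if_neg hpt] at h
    change Summable (fun n : ℕ => ((n : ℝ) + 1) ^ (r * p.toReal - 1) * rearr (A T) n ^ p.toReal) at h
    simp only [rearr_eq (A_antitone T) (A_nonneg T)] at h
    obtain ⟨M, hM⟩ := hu (∑' n : ℕ, ((n : ℝ) + 1) ^ (r * p.toReal - 1) * A T n ^ p.toReal)
    exact absurd (h.sum_le_tsum (Finset.range M) fun n _ => term_nonneg _ _ (A_nonneg T) n)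
      (not_le.2 hM)
end

section
/- Let X, Y be infinite-dimensional Banach spaces and fix 0 < p, q < ∞, 0 < r, e < ∞. Then L^{(a)}_{p,r+e}(X,Y) is strictly contained in L^{(a)}_{q,r}(X,Y). -/
/-- Membership in the Lorentz sequence space `ℓ_{p,r}` for finite `p`. -/
def MemLorentz (p r : ℝ) (a : ℕ → ℝ) : Prop :=
  (∃ M, ∀ n, |a n| ≤ M) ∧
    Summable (fun n : ℕ => ((n : ℝ) + 1) ^ (r * p - 1) * rearr a n ^ p)

/-- Auerbach systems in finite-dimensional spaces. -/
theorem auerbach_fd {E : Type*} [NormedAddCommGroup E] [NormedSpace ℝ E] [FiniteDimensional ℝ E]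
    {N : ℕ} (b : Module.Basis (Fin N) ℝ E) :
    ∃ (x : Fin N → E) (f : Fin N → (E →L[ℝ] ℝ)), (∀ i, ‖x i‖ ≤ 1) ∧ (∀ i, ‖f i‖ ≤ 1) ∧
      ∀ i j, f i (x j) = if i = j then 1 else 0 := by
  classical
  have hcont : Continuous (fun v : Fin N → E => |b.det v|) := by
    refine continuous_abs.comp ?_
    have : (fun v : Fin N → E => b.det v) = fun v => (b.toMatrix v).det := by
      funext v; exact b.det_apply v
    change Continuous (fun v : Fin N → E => b.det v)
    rw [this]
    apply Continuous.matrix_det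
    refine continuous_matrix fun i j => ?_
    have h1 : Continuous (b.coord i) := LinearMap.continuous_of_finiteDimensional _
    exact h1.comp (continuous_apply j)
  have hK : IsCompact (Set.univ.pi fun _ : Fin N => Metric.closedBall (0 : E) 1) :=
    isCompact_univ_pi fun _ => isCompact_closedBall _ _
  obtain ⟨v, hv, hmax⟩ := hK.exists_isMaxOn ⟨0, by simp⟩ hcont.continuousOn
  have hv1 : ∀ i, ‖v i‖ ≤ 1 := fun i => by simpa using hv i (Set.mem_univ _)
  have hne : b.det v ≠ 0 := by
    intro h0
    have hmem : (fun i => (‖b i‖⁻¹ : ℝ) • b i) ∈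
        (Set.univ.pi fun _ : Fin N => Metric.closedBall (0 : E) 1) := by
      intro i _
      simp only [Metric.mem_closedBall, dist_zero_right]
      rw [norm_smul, norm_inv, norm_norm]
      exact inv_mul_le_one
    have h1 : |b.det (fun i => (‖b i‖⁻¹ : ℝ) • b i)| ≤ |b.det v| := hmax hmem
    rw [h0, abs_zero, abs_nonpos_iff] at h1
    have h2 := b.det.toMultilinearMap.map_smul_univ (fun i => (‖b i‖⁻¹ : ℝ)) (fun i => b i)
    have h3 : b.det (fun i => (‖b i‖⁻¹ : ℝ) • b i) = (∏ i, (‖b i‖⁻¹ : ℝ)) * b.det b := by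
      simpa using h2
    rw [h3, b.det_self, mul_one] at h1
    rw [Finset.prod_eq_zero_iff] at h1
    obtain ⟨i, -, hi⟩ := h1
    exact b.ne_zero i (norm_eq_zero.1 (inv_eq_zero.1 hi))
  let g : Fin N → (E →ₗ[ℝ] ℝ) := fun i => (b.det v)⁻¹ • b.det.toMultilinearMap.toLinearMap v i
  have hg : ∀ i z, g i z = (b.det v)⁻¹ * b.det (Function.update v i z) := fun i z => rfl
  refine ⟨v, fun i => LinearMap.toContinuousLinearMap (g i), hv1, ?_, ?_⟩
  · intro i
    refine ContinuousLinearMap.opNorm_le_of_unit_norm zero_le_one ?_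
    intro z hz
    have hmem : Function.update v i z ∈
        (Set.univ.pi fun _ : Fin N => Metric.closedBall (0 : E) 1) := by
      intro j _
      by_cases hj : j = i
      · subst hj; simp [hz]
      · simpa [Function.update_of_ne hj] using hv1 j
    have h1 : |b.det (Function.update v i z)| ≤ |b.det v| := hmax hmem
    simp only [LinearMap.coe_toContinuousLinearMap']
    rw [hg, norm_mul, norm_inv, Real.norm_eq_abs, Real.norm_eq_abs]
    rw [inv_mul_le_iff₀ (abs_pos.2 hne)]
    simpa using h1
  · intro i j
    simp only [LinearMap.coe_toContinuousLinearMap']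
    rw [hg]
    split_ifs with h
    · subst h; simp [hne]
    · have h0 : b.det (Function.update v i (v j)) = 0 := by
        apply AlternatingMap.map_eq_zero_of_eq (i := i) (j := j) b.det _ _ h
        simp [Function.update_of_ne (Ne.symm h)]
      rw [h0, mul_zero]

theorem auerbach_inf {E : Type*} [NormedAddCommGroup E] [NormedSpace ℝ E]
    (hE : ¬ FiniteDimensional ℝ E) (N : ℕ) :
    ∃ (x : Fin N → E) (f : Fin N → (E →L[ℝ] ℝ)), (∀ i, ‖x i‖ ≤ 1) ∧ (∀ i, ‖f i‖ ≤ 1) ∧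
      ∀ i j, f i (x j) = if i = j then 1 else 0 := by
  have hr : ((N : ℕ) : Cardinal) ≤ Module.rank ℝ E := by
    by_contra h
    rw [not_le] at h
    exact hE (Module.rank_lt_aleph0_iff.1 (h.trans (Cardinal.natCast_lt_aleph0)))
  obtain ⟨w, hw⟩ := exists_linearIndependent_of_le_rank hr
  let b := Module.Basis.span hw
  have : FiniteDimensional ℝ (Submodule.span ℝ (Set.range w)) := Module.Finite.of_basis b
  obtain ⟨x, f, hx, hf, hxf⟩ := auerbach_fd b
  choose F hF hFn using fun i => exists_extension_norm_eq (Submodule.span ℝ (Set.range w)) (f i)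
  refine ⟨fun i => x i, F, fun i => hx i, fun i => (hFn i).le.trans (hf i), fun i j => ?_⟩
  rw [hF, hxf]

section
variable {X Y : Type*} [NormedAddCommGroup X] [NormedSpace ℝ X]
    [NormedAddCommGroup Y] [NormedSpace ℝ Y]

/-- rank at most `n` -/
def RkLE (S : X →L[ℝ] Y) (n : ℕ) : Prop :=
  Module.rank ℝ (LinearMap.range (S : X →ₗ[ℝ] Y)) ≤ (n : Cardinal)

theorem RkLE.mono {S : X →L[ℝ] Y} {m n : ℕ} (h : RkLE S m) (hmn : m ≤ n) : RkLE S n :=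
  le_trans h (by exact_mod_cast hmn)

theorem rk_lt_iff {S : X →L[ℝ] Y} {n : ℕ} :
    Module.rank ℝ (LinearMap.range (S : X →ₗ[ℝ] Y)) < (n : Cardinal) ↔ ∃ j < n, RkLE S j := by
  constructor
  · intro h
    obtain ⟨j, hj⟩ := Cardinal.lt_aleph0.1 (h.trans (Cardinal.natCast_lt_aleph0))
    refine ⟨j, ?_, hj.le⟩
    rw [hj] at h
    exact_mod_cast h
  · rintro ⟨j, hj, h⟩
    exact lt_of_le_of_lt h (by exact_mod_cast hj)

theorem RkLE.add {S T : X →L[ℝ] Y} {m n : ℕ} (hS : RkLE S m) (hT : RkLE T n) :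
    RkLE (S + T) (m + n) := by
  have := LinearMap.rank_add_le (S : X →ₗ[ℝ] Y) (T : X →ₗ[ℝ] Y)
  refine le_trans this ?_
  push_cast
  exact add_le_add hS hT

theorem RkLE.zero (n : ℕ) : RkLE (0 : X →L[ℝ] Y) n := by
  have : (LinearMap.rank (0 : X →ₗ[ℝ] Y)) = 0 := LinearMap.rank_zero
  refine le_trans (le_of_eq this) ?_
  simp

theorem RkLE.smul {S : X →L[ℝ] Y} {m : ℕ} (hS : RkLE S m) (c : ℝ) : RkLE (c • S) m := by
  have h := LinearMap.rank_comp_le_right (S : X →ₗ[ℝ] Y) (c • (LinearMap.id : Y →ₗ[ℝ] Y))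
  refine le_trans ?_ hS
  exact h

theorem RkLE.sub {S T : X →L[ℝ] Y} {m n : ℕ} (hS : RkLE S m) (hT : RkLE T n) :
    RkLE (S - T) (m + n) := by
  have := hS.add (hT.smul (-1))
  rwa [neg_one_smul, ← sub_eq_add_neg] at this

theorem RkLE.sum {ι : Type*} (s : Finset ι) (S : ι → X →L[ℝ] Y) (m : ι → ℕ)
    (h : ∀ i, RkLE (S i) (m i)) : RkLE (∑ i ∈ s, S i) (∑ i ∈ s, m i) := by
  classical
  induction s using Finset.induction_on with
  | empty => simpa using RkLE.zero 0
  | insert a s ha ih =>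
    rw [Finset.sum_insert ha, Finset.sum_insert ha]
    exact (h a).add ih

theorem RkLE.smulRight (f : X →L[ℝ] ℝ) (y : Y) : RkLE (f.smulRight y) 1 := by
  have h1 : LinearMap.range ((f.smulRight y : X →L[ℝ] Y) : X →ₗ[ℝ] Y) ≤ Submodule.span ℝ {y} := by
    rintro _ ⟨x, rfl⟩
    exact Submodule.smul_mem _ _ (Submodule.mem_span_singleton_self y)
  refine le_trans (Submodule.rank_mono h1) ?_
  refine le_trans (rank_span_le _) ?_
  simp

theorem exists_ker_of_rk {N j : ℕ} (hj : j < N) {S : X →L[ℝ] Y} (hS : RkLE S j) (x : Fin N → X) :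
    ∃ t : Fin N → ℝ, t ≠ 0 ∧ S (∑ i, t i • x i) = 0 := by
  let L : (Fin N → ℝ) →ₗ[ℝ] X := Fintype.linearCombination ℝ x
  have : FiniteDimensional ℝ (LinearMap.range (S : X →ₗ[ℝ] Y)) :=
    Module.rank_lt_aleph0_iff.1 (lt_of_le_of_lt hS (Cardinal.natCast_lt_aleph0))
  have hfr : Module.finrank ℝ (LinearMap.range (S : X →ₗ[ℝ] Y)) ≤ j := by
    have h : Module.rank ℝ (LinearMap.range (S : X →ₗ[ℝ] Y)) ≤ (j : Cardinal) := hS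
    rw [← Module.finrank_eq_rank] at h
    exact_mod_cast h
  let F : (Fin N → ℝ) →ₗ[ℝ] LinearMap.range (S : X →ₗ[ℝ] Y) :=
    (LinearMap.rangeRestrict (S : X →ₗ[ℝ] Y)).comp L
  have hker : LinearMap.ker F ≠ ⊥ := LinearMap.ker_ne_bot_of_finrank_lt (by simp; omega)
  obtain ⟨t, ht, ht0⟩ := Submodule.exists_mem_ne_zero_of_ne_bot hker
  refine ⟨t, ht0, ?_⟩
  have := congrArg Subtype.val (LinearMap.mem_ker.1 ht)
  simpa [F, L, Fintype.linearCombination_apply] using this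

theorem base_op (hX : ¬ FiniteDimensional ℝ X) (hY : ¬ FiniteDimensional ℝ Y) (N : ℕ) :
    ∃ T : X →L[ℝ] Y, RkLE T N ∧ ‖T‖ ≤ N ∧ ∀ (S : X →L[ℝ] Y) (j : ℕ), j < N → RkLE S j →
      1 ≤ N * ‖T - S‖ := by
  obtain ⟨x, f, hx, hf, hxf⟩ := auerbach_inf hX N
  obtain ⟨y, g, hy, hg, hyg⟩ := auerbach_inf hY N
  refine ⟨∑ i, (f i).smulRight (y i), ?_, ?_, ?_⟩
  · simpa using RkLE.sum Finset.univ (fun i => (f i).smulRight (y i)) (fun _ => 1)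
      (fun i => RkLE.smulRight _ _)
  · refine (norm_sum_le _ _).trans ?_
    have : ∀ i ∈ (Finset.univ : Finset (Fin N)), ‖(f i).smulRight (y i)‖ ≤ 1 := by
      intro i _
      rw [ContinuousLinearMap.norm_smulRight_apply]
      exact mul_le_one₀ (hf i) (norm_nonneg _) (hy i)
    simpa using Finset.sum_le_sum this
  · intro S j hj hS
    obtain ⟨t, ht0, ht⟩ := exists_ker_of_rk hj hS x
    have hN : 0 < N := by omega
    have : Nonempty (Fin N) := ⟨⟨0, hN⟩⟩
    obtain ⟨i, hi⟩ := Finite.exists_max (fun i => |t i|)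
    have hti : 0 < |t i| := by
      obtain ⟨l, hl⟩ := Function.ne_iff.1 ht0
      exact lt_of_lt_of_le (abs_pos.2 hl) (hi l)
    set T : X →L[ℝ] Y := ∑ i, (f i).smulRight (y i) with hT
    set z : X := ∑ i, t i • x i with hz
    have hzn : ‖z‖ ≤ N * |t i| := by
      refine (norm_sum_le _ _).trans ?_
      have : ∀ l ∈ (Finset.univ : Finset (Fin N)), ‖t l • x l‖ ≤ |t i| := by
        intro l _
        rw [norm_smul, Real.norm_eq_abs]
        calc |t l| * ‖x l‖ ≤ |t l| * 1 := by gcongr; exact hx l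
          _ ≤ |t i| := by simpa using hi l
      simpa using Finset.sum_le_sum this
    have hfz : ∀ l, f l z = t l := by
      intro l
      simp [hz, hxf]
    have hTz : g i (T z) = t i := by
      simp [hT, hfz, hyg]
    have h1 : |t i| ≤ ‖T - S‖ * (N * |t i|) := by
      calc |t i| = ‖g i ((T - S) z)‖ := by
            rw [sub_apply, ht, sub_zero, hTz, Real.norm_eq_abs]
        _ ≤ ‖g i‖ * ‖(T - S) z‖ := (g i).le_opNorm _
        _ ≤ 1 * ‖(T - S) z‖ := by gcongr; exact hg i
        _ = ‖(T - S) z‖ := one_mul _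
        _ ≤ ‖T - S‖ * ‖z‖ := (T - S).le_opNorm _
        _ ≤ ‖T - S‖ * (N * |t i|) := by gcongr
    have h2 : 1 * |t i| ≤ (N * ‖T - S‖) * |t i| := by linarith
    exact le_of_mul_le_mul_right h2 hti

theorem key_op (hX : ¬ FiniteDimensional ℝ X) (hY : ¬ FiniteDimensional ℝ Y) {δ : ℝ} (hδ : 0 < δ) :
    ∃ M : ℕ, 1 ≤ M ∧ ∃ n₀ : ℕ, 1 ≤ n₀ ∧ ∀ n ≥ n₀, ∃ T : X →L[ℝ] Y, RkLE T (M * n) ∧ ‖T‖ ≤ 1 ∧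
      ∀ (S : X →L[ℝ] Y) (j : ℕ), j < n → RkLE S j → (n : ℝ) ^ (-δ) ≤ ‖T - S‖ := by
  obtain ⟨m, hm⟩ := exists_nat_ge (3 / δ)
  have hmδ : 3 ≤ δ * m := by
    rw [div_le_iff₀ hδ] at hm; linarith
  have hm1 : 1 ≤ m := by
    rcases Nat.eq_zero_or_pos m with h | h
    · subst h; norm_num at hmδ
    · exact h
  refine ⟨2 * m, by omega, m ^ 2 + 1, by omega, fun n hn => ?_⟩
  have hn1 : 1 ≤ n := by omega
  by_contra hcon
  push Not at hcon
  have hnpos : (0 : ℝ) < n := by exact_mod_cast hn1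
  have hP : ∀ T : X →L[ℝ] Y, RkLE T (2 * m * n) → ∃ S : X →L[ℝ] Y, ∃ j < n, RkLE S j ∧
      ‖T - S‖ ≤ (n : ℝ) ^ (-δ) * ‖T‖ := by
    intro T hT
    by_cases hT0 : T = 0
    · refine ⟨0, 0, by omega, RkLE.zero 0, ?_⟩
      simp [hT0]
    have hTn : 0 < ‖T‖ := norm_pos_iff.2 hT0
    obtain ⟨S, j, hj, hS, hlt⟩ := hcon (‖T‖⁻¹ • T) (hT.smul _) (by
      rw [norm_smul, norm_inv, norm_norm]; exact inv_mul_le_one)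
    refine ⟨‖T‖ • S, j, hj, hS.smul _, ?_⟩
    have : T - ‖T‖ • S = ‖T‖ • (‖T‖⁻¹ • T - S) := by
      rw [smul_sub, smul_smul, mul_inv_cancel₀ hTn.ne', one_smul]
    rw [this, norm_smul, norm_norm, mul_comm]
    gcongr
  obtain ⟨T, hT, hTn, hTS⟩ := base_op (X := X) (Y := Y) hX hY (m * n)
  have hit : ∀ i ≤ m, ∃ S : X →L[ℝ] Y, RkLE S (i * (n - 1)) ∧
      ‖T - S‖ ≤ ((n : ℝ) ^ (-δ)) ^ i * ‖T‖ := by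
    intro i
    induction i with
    | zero => intro _; exact ⟨0, RkLE.zero _, by simp⟩
    | succ i ih =>
      intro hi
      obtain ⟨S, hS, hSn⟩ := ih (by omega)
      have hle : m * n + i * (n - 1) ≤ 2 * m * n := by
        have : i * (n - 1) ≤ m * n := Nat.mul_le_mul (by omega) (by omega)
        linarith
      obtain ⟨S', j, hj, hS', hn'⟩ := hP (T - S) ((hT.sub hS).mono hle)
      refine ⟨S + S', (hS.add hS').mono ?_, ?_⟩
      · rw [Nat.succ_mul]; omega
      · rw [← sub_sub, pow_succ]
        refine hn'.trans ?_
        calc (n : ℝ) ^ (-δ) * ‖T - S‖ ≤ (n : ℝ) ^ (-δ) * (((n : ℝ) ^ (-δ)) ^ i * ‖T‖) := by gcongr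
          _ = _ := by ring
  obtain ⟨S, hS, hSn⟩ := hit m le_rfl
  have h1 := hTS S (m * (n - 1)) (Nat.mul_lt_mul_of_pos_left (by omega) (by omega)) hS
  have h2 : ((n : ℝ) ^ (-δ)) ^ m ≤ (n : ℝ) ^ (-3 : ℝ) := by
    rw [← Real.rpow_natCast, ← Real.rpow_mul hnpos.le]
    apply Real.rpow_le_rpow_of_exponent_le
    · exact_mod_cast hn1
    · linarith
  have h3 : (n : ℝ) ^ (-3 : ℝ) = ((n : ℝ) ^ 3)⁻¹ := by
    rw [Real.rpow_neg hnpos.le]; norm_cast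
  rw [h3] at h2
  push_cast at h1 hTn
  have h4 : (1 : ℝ) ≤ (m * n) * (((n : ℝ) ^ 3)⁻¹ * (m * n)) := by
    refine h1.trans ?_
    gcongr
    refine hSn.trans ?_
    gcongr
  have h5 : (m * n : ℝ) * (((n : ℝ) ^ 3)⁻¹ * (m * n)) = m ^ 2 / n := by
    field_simp
  rw [h5, le_div_iff₀ hnpos, one_mul] at h4
  have h6 : n ≤ m ^ 2 := by exact_mod_cast h4
  omega
end

theorem rearr_eq {a : ℕ → ℝ} (ha : Antitone a) (h0 : ∀ n, 0 ≤ a n) (n : ℕ) : rearr a n = a n := by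
  have habs : ∀ m, |a m| = a m := fun m => abs_of_nonneg (h0 m)
  unfold rearr
  simp only [habs]
  have hsub : {m : ℕ | a n < a m} ⊆ Set.Iio n := by
    intro m hm
    by_contra hle
    simp only [Set.mem_Iio, not_lt] at hle
    exact absurd (ha hle) (not_le.2 hm)
  apply le_antisymm
  · apply csInf_le ⟨0, fun t ht => ht.1⟩
    refine ⟨h0 n, (Set.finite_Iio n).subset hsub, ?_⟩
    have := Set.ncard_le_ncard hsub (Set.finite_Iio n)
    rw [Set.ncard_eq_toFinset_card' (Set.Iio n)] at this
    simpa [Nat.card_coe_set_eq] using this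
  · refine le_csInf ⟨a n, h0 n, (Set.finite_Iio n).subset hsub, ?_⟩ ?_
    · have := Set.ncard_le_ncard hsub (Set.finite_Iio n)
      rw [Set.ncard_eq_toFinset_card' (Set.Iio n)] at this
      simpa [Nat.card_coe_set_eq] using this
    · rintro t ⟨-, hfin, hcard⟩
      by_contra hlt
      rw [not_le] at hlt
      have hsup : Set.Iic n ⊆ {m : ℕ | t < a m} := fun m hm => lt_of_lt_of_le hlt (ha hm)
      have := Set.ncard_le_ncard hsup hfin
      rw [Set.ncard_eq_toFinset_card' (Set.Iic n)] at this
      have h2 : n + 1 ≤ Nat.card {m : ℕ | t < a m} := by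
        rw [Nat.card_coe_set_eq]; simpa using this
      omega

theorem lorentz_decay {a : ℕ → ℝ} (ha : Antitone a) (h0 : ∀ n, 0 ≤ a n) {p s : ℝ} (hp : 0 < p)
    (hs : 0 < s) (h : MemLorentz p s a) : ∃ C : ℝ, ∀ n : ℕ, a n ≤ C * ((n : ℝ) + 1) ^ (-s) := by
  obtain ⟨-, hsum⟩ := h
  simp only [rearr_eq ha h0] at hsum
  set B := ∑' n : ℕ, ((n : ℝ) + 1) ^ (s * p - 1) * a n ^ p with hB
  have hterm : ∀ n : ℕ, 0 ≤ ((n : ℝ) + 1) ^ (s * p - 1) * a n ^ p := fun n => by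
    have := h0 n; positivity
  have key : ∀ n : ℕ, (1 / 2 : ℝ) ^ (s * p + 1) * ((n : ℝ) + 1) ^ (s * p) * a n ^ p ≤ B := by
    intro n
    have hn : (0 : ℝ) < (n : ℝ) + 1 := by positivity
    have h1 : ∀ j ∈ Finset.Ico (n / 2) (n + 1),
        (((n : ℝ) + 1) / 2) ^ (s * p) / ((n : ℝ) + 1) * a n ^ p ≤
          ((j : ℝ) + 1) ^ (s * p - 1) * a j ^ p := by
      intro j hj
      rw [Finset.mem_Ico] at hj
      have hj1 : (0 : ℝ) < (j : ℝ) + 1 := by positivity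
      rw [Real.rpow_sub_one hj1.ne']
      have e1 : ((n : ℝ) + 1) / 2 ≤ (j : ℝ) + 1 := by
        have : n + 1 ≤ 2 * (j + 1) := by omega
        have : ((n : ℝ) + 1) ≤ 2 * ((j : ℝ) + 1) := by exact_mod_cast this
        linarith
      have e2 : (j : ℝ) + 1 ≤ (n : ℝ) + 1 := by
        have : j ≤ n := by omega
        have : (j : ℝ) ≤ n := by exact_mod_cast this
        linarith
      have e3 : a n ≤ a j := ha (by omega)
      have := h0 n
      gcongr
    have h2 := Finset.card_nsmul_le_sum _ _ _ h1
    have h3 := hsum.sum_le_tsum (Finset.Ico (n / 2) (n + 1)) (fun i _ => hterm i)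
    refine le_trans ?_ (h2.trans h3)
    rw [nsmul_eq_mul, Nat.card_Ico]
    have hc : ((n : ℝ) + 1) / 2 ≤ ((n + 1 - n / 2 : ℕ) : ℝ) := by
      have : n + 1 ≤ 2 * (n + 1 - n / 2) := by omega
      have : ((n : ℝ) + 1) ≤ 2 * ((n + 1 - n / 2 : ℕ) : ℝ) := by exact_mod_cast this
      linarith
    have hnn := h0 n
    calc (1 / 2 : ℝ) ^ (s * p + 1) * ((n : ℝ) + 1) ^ (s * p) * a n ^ p
        = ((n : ℝ) + 1) / 2 * ((((n : ℝ) + 1) / 2) ^ (s * p) / ((n : ℝ) + 1) * a n ^ p) := by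
          rw [Real.rpow_add_one (by norm_num), div_eq_mul_one_div ((n : ℝ) + 1) 2,
            Real.mul_rpow hn.le (by norm_num)]
          field_simp
      _ ≤ _ := by gcongr
  set c : ℝ := (1 / 2 : ℝ) ^ (s * p + 1) with hc
  have hcpos : 0 < c := by positivity
  have hB0 : 0 ≤ B := tsum_nonneg hterm
  refine ⟨(B / c) ^ (1 / p), fun n => ?_⟩
  have hn : (0 : ℝ) < (n : ℝ) + 1 := by positivity
  have hk := key n
  have h4 : a n ^ p ≤ ((B / c) ^ (1 / p) * ((n : ℝ) + 1) ^ (-s)) ^ p := by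
    rw [Real.mul_rpow (by positivity) (by positivity), ← Real.rpow_mul (by positivity),
      ← Real.rpow_mul hn.le, one_div_mul_cancel hp.ne', Real.rpow_one, neg_mul,
      Real.rpow_neg hn.le, ← div_eq_mul_inv, div_div, le_div_iff₀ (by positivity)]
    linarith
  exact (Real.rpow_le_rpow_iff (h0 n) (by positivity) hp).1 h4

theorem decay_lorentz {a : ℕ → ℝ} (ha : Antitone a) (h0 : ∀ n, 0 ≤ a n) {q r s C : ℝ} (hq : 0 < q)
    (hrs : r < s) (h : ∀ n : ℕ, a n ≤ C * ((n : ℝ) + 1) ^ (-s)) : MemLorentz q r a := by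
  refine ⟨⟨a 0, fun n => by rw [abs_of_nonneg (h0 n)]; exact ha (Nat.zero_le n)⟩, ?_⟩
  simp only [rearr_eq ha h0]
  have hC : 0 ≤ C := by
    have := (h0 0).trans (h 0)
    simpa using this
  have hs1 : Summable (fun n : ℕ => C ^ q * ((n : ℝ) + 1) ^ (-1 - (s - r) * q)) := by
    apply Summable.mul_left
    have h1 : Summable (fun n : ℕ => (n : ℝ) ^ (-1 - (s - r) * q)) := by
      rw [Real.summable_nat_rpow]
      have : 0 < (s - r) * q := mul_pos (by linarith) hq
      linarith
    have h2 := (summable_nat_add_iff 1).2 h1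
    simpa using h2
  refine Summable.of_nonneg_of_le (fun n => ?_) (fun n => ?_) hs1
  · have := h0 n; positivity
  · have hn : (0 : ℝ) < (n : ℝ) + 1 := by positivity
    have := h0 n
    calc ((n : ℝ) + 1) ^ (r * q - 1) * a n ^ q
        ≤ ((n : ℝ) + 1) ^ (r * q - 1) * (C * ((n : ℝ) + 1) ^ (-s)) ^ q := by gcongr; exact h n
      _ = _ := by
        rw [Real.mul_rpow hC (by positivity), ← Real.rpow_mul hn.le, mul_left_comm,
          ← Real.rpow_add hn]
        congr 2; ring

section
variable {X Y : Type*} [NormedAddCommGroup X] [NormedSpace ℝ X]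
    [NormedAddCommGroup Y] [NormedSpace ℝ Y]

theorem approx_le {T S : X →L[ℝ] Y} {n j : ℕ} (hj : j < n) (hS : RkLE S j) :
    approxNum n T ≤ ‖T - S‖ := by
  apply csInf_le
  · refine ⟨0, ?_⟩
    rintro _ ⟨S, -, rfl⟩
    exact norm_nonneg _
  · exact ⟨S, rk_lt_iff.2 ⟨j, hj, hS⟩, rfl⟩

theorem le_approx {T : X →L[ℝ] Y} {n : ℕ} (hn : 0 < n) {b : ℝ}
    (h : ∀ (S : X →L[ℝ] Y) (j : ℕ), j < n → RkLE S j → b ≤ ‖T - S‖) : b ≤ approxNum n T := by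
  apply le_csInf
  · exact ⟨_, 0, rk_lt_iff.2 ⟨0, hn, RkLE.zero 0⟩, rfl⟩
  · rintro _ ⟨S, hS, rfl⟩
    obtain ⟨j, hj, hS⟩ := rk_lt_iff.1 hS
    exact h S j hj hS

theorem approx_anti (T : X →L[ℝ] Y) : Antitone (fun n : ℕ => approxNum (n + 1) T) := by
  intro m n hmn
  exact le_approx (Nat.succ_pos _) fun S j hj hS => approx_le (by omega) hS

theorem approx_nonneg (T : X →L[ℝ] Y) (n : ℕ) : 0 ≤ approxNum (n + 1) T :=
  le_approx (Nat.succ_pos _) fun _ _ _ _ => norm_nonneg _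

theorem exists_seq {s δ : ℝ} (hs : 0 < s) (M n₀ : ℕ) (hn₀ : 1 ≤ n₀) (hM : 1 ≤ M) :
    ∃ n : ℕ → ℕ, (∀ k, n₀ ≤ n k) ∧ (∀ k, 4 * M * n k ≤ n (k + 1)) ∧
      ∀ k, 4 * (n (k + 1) : ℝ) ^ (-s) ≤ (n k : ℝ) ^ (-(s + δ)) := by
  have hstep : ∀ m : ℕ, ∃ m' : ℕ, n₀ ≤ m' ∧ 4 * M * m ≤ m' ∧
      (1 ≤ m → 4 * (m' : ℝ) ^ (-s) ≤ (m : ℝ) ^ (-(s + δ))) := by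
    intro m
    by_cases hm : 1 ≤ m
    · have hmp : (0 : ℝ) < m := by exact_mod_cast hm
      have ht : Filter.Tendsto (fun x : ℕ => 4 * (x : ℝ) ^ (-s)) Filter.atTop (nhds (4 * 0)) :=
        ((tendsto_rpow_neg_atTop hs).comp tendsto_natCast_atTop_atTop).const_mul 4
      rw [mul_zero] at ht
      have hpos : (0 : ℝ) < (m : ℝ) ^ (-(s + δ)) := by positivity
      obtain ⟨m', h1, h2, h3⟩ := ((ht.eventually (ge_mem_nhds hpos)).and
        ((Filter.eventually_ge_atTop n₀).and (Filter.eventually_ge_atTop (4 * M * m)))).exists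
      exact ⟨m', h2, h3, fun _ => h1⟩
    · exact ⟨n₀ + 4 * M * m, by omega, by omega, fun h => absurd h hm⟩
  choose Φ h1 h2 h3 using hstep
  let n : ℕ → ℕ := fun k => Nat.rec n₀ (fun _ x => Φ x) k
  have hn : ∀ k, n (k + 1) = Φ (n k) := fun k => rfl
  have hge : ∀ k, n₀ ≤ n k := by
    intro k
    cases k with
    | zero => exact le_rfl
    | succ k => rw [hn]; exact h1 _
  exact ⟨n, hge, fun k => h2 _, fun k => h3 _ (hn₀.trans (hge k))⟩

theorem main_op [CompleteSpace Y] (hX : ¬ FiniteDimensional ℝ X) (hY : ¬ FiniteDimensional ℝ Y)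
    {s δ : ℝ} (hs : 0 < s) (hδ : 0 < δ) :
    ∃ T : X →L[ℝ] Y, (∃ C : ℝ, ∀ n : ℕ, approxNum (n + 1) T ≤ C * ((n : ℝ) + 1) ^ (-s)) ∧
      ¬ ∃ C : ℝ, ∀ n : ℕ, approxNum (n + 1) T ≤ C * ((n : ℝ) + 1) ^ (-(s + 2 * δ)) := by
  obtain ⟨M, hM, n₀, hn₀, hkey⟩ := key_op (X := X) (Y := Y) hX hY hδ
  obtain ⟨n, hn0, hn4, hnc⟩ := exists_seq (s := s) (δ := δ) hs M n₀ hn₀ hM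
  choose U hUrk hUn hUlow using fun k => hkey (n k) (hn0 k)
  have hn1 : ∀ k, 1 ≤ n k := fun k => hn₀.trans (hn0 k)
  have hnpos : ∀ k, (0 : ℝ) < n k := fun k => by exact_mod_cast hn1 k
  let c : ℕ → ℝ := fun k => (n k : ℝ) ^ (-s)
  have hcpos : ∀ k, 0 < c k := fun k => by have := hnpos k; positivity
  have hc4 : ∀ k, 4 * c (k + 1) ≤ c k * (n k : ℝ) ^ (-δ) := by
    intro k
    have := hnc k
    rwa [neg_add, Real.rpow_add (hnpos k)] at this
  have hc2 : ∀ k, c (k + 1) ≤ c k * (1 / 2) := by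
    intro k
    have h1 : (n k : ℝ) ^ (-δ) ≤ 1 :=
      Real.rpow_le_one_of_one_le_of_nonpos (by exact_mod_cast hn1 k) (by linarith)
    have h2 : c k * (n k : ℝ) ^ (-δ) ≤ c k * 1 := by
      have := hcpos k; gcongr
    linarith [hc4 k, hcpos k, hcpos (k + 1)]
  have hcgeo : ∀ k j, c (j + k) ≤ c k * (1 / 2) ^ j := by
    intro k j
    induction j with
    | zero => simp
    | succ j ih =>
      have := hc2 (j + k)
      rw [show j + 1 + k = j + k + 1 by ring, pow_succ]
      linarith
  have hgs : ∀ k, HasSum (fun j : ℕ => c k * (1 / 2 : ℝ) ^ j) (2 * c k) := by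
    intro k
    have := hasSum_geometric_two.mul_left (c k)
    rwa [mul_comm (c k) 2] at this
  have hVn : ∀ k j, ‖c (j + k) • U (j + k)‖ ≤ c k * (1 / 2 : ℝ) ^ j := by
    intro k j
    rw [norm_smul, Real.norm_eq_abs, abs_of_pos (hcpos _)]
    calc c (j + k) * ‖U (j + k)‖ ≤ c (j + k) * 1 := by
          have := hcpos (j + k); gcongr; exact hUn _
      _ ≤ _ := by rw [mul_one]; exact hcgeo k j
  have hsumm : Summable (fun j => c j • U j) :=
    Summable.of_norm_bounded (hgs 0).summable (fun j => hVn 0 j)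
  let T : X →L[ℝ] Y := ∑' j, c j • U j
  let P : ℕ → X →L[ℝ] Y := fun k => ∑ j ∈ Finset.range k, c j • U j
  have htail : ∀ k, ‖T - P k‖ ≤ 2 * c k := by
    intro k
    have h1 : T - P k = ∑' j, c (j + k) • U (j + k) := by
      rw [sub_eq_iff_eq_add, add_comm]
      exact (hsumm.sum_add_tsum_nat_add k).symm
    rw [h1]
    exact tsum_of_norm_bounded (hgs k) (hVn k)
  let σ : ℕ → ℕ := fun k => ∑ j ∈ Finset.range k, M * n j
  have hPrk : ∀ k, RkLE (P k) (σ k) := fun k => RkLE.sum _ _ _ fun j => (hUrk j).smul _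
  have hσs : ∀ k, σ (k + 1) = σ k + M * n k := fun k => Finset.sum_range_succ _ _
  have hσ : ∀ k, 2 * σ k ≤ n k := by
    intro k
    induction k with
    | zero => simp [σ]
    | succ k ih =>
      have h1 := hn4 k
      have h2 : n k ≤ M * n k := Nat.le_mul_of_pos_left _ (by omega)
      rw [hσs]
      have h3 : 4 * M * n k = 4 * (M * n k) := by ring
      omega
  have hngrow : ∀ k, k < n k := by
    intro k
    induction k with
    | zero => exact hn1 0
    | succ k ih =>
      have h1 := hn4 k
      have h2 : n k ≤ M * n k := Nat.le_mul_of_pos_left _ (by omega)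
      have h3 : 4 * M * n k = 4 * (M * n k) := by ring
      omega
  refine ⟨T, ⟨2 * (2 * M : ℝ) ^ s, ?_⟩, ?_⟩
  · intro m
    have hex : ∃ k, m + 1 ≤ σ (k + 1) := by
      refine ⟨m + 1, ?_⟩
      have h1 := hngrow (m + 1)
      have h2 : n (m + 1) ≤ M * n (m + 1) := Nat.le_mul_of_pos_left _ (by omega)
      rw [hσs]; omega
    classical
    obtain ⟨k, hk, hkmin⟩ : ∃ k, m + 1 ≤ σ (k + 1) ∧ σ k < m + 1 := by
      refine ⟨Nat.find hex, Nat.find_spec hex, ?_⟩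
      rcases Nat.eq_zero_or_pos (Nat.find hex) with h | h
      · rw [h]; simp [σ]
      · have := Nat.find_min hex (m := Nat.find hex - 1) (by omega)
        rw [Nat.sub_add_cancel h] at this
        omega
    have h1 : approxNum (m + 1) T ≤ 2 * c k := (approx_le hkmin (hPrk k)).trans (htail k)
    refine h1.trans ?_
    have h2 : m + 1 ≤ 2 * M * n k := by
      have h2 : n k ≤ M * n k := Nat.le_mul_of_pos_left _ (by omega)
      have h3 : 2 * M * n k = 2 * (M * n k) := by ring
      have := hσ k
      rw [hσs] at hk
      omega
    have h3 : ((m : ℝ) + 1) ≤ 2 * M * n k := by exact_mod_cast h2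
    have hMp : (0 : ℝ) < 2 * M := by
      have : (0 : ℝ) < M := by exact_mod_cast hM
      positivity
    have hm : (0 : ℝ) < (m : ℝ) + 1 := by positivity
    have h4 : (2 * M * n k : ℝ) ^ (-s) ≤ ((m : ℝ) + 1) ^ (-s) :=
      Real.rpow_le_rpow_of_nonpos hm h3 (by linarith)
    rw [Real.mul_rpow hMp.le (hnpos k).le, Real.rpow_neg hMp.le,
      inv_mul_le_iff₀ (by positivity)] at h4
    change 2 * (n k : ℝ) ^ (-s) ≤ _
    linarith
  · rintro ⟨C, hC⟩
    have hlow : ∀ k, (n k : ℝ) ^ (-(s + δ)) / 2 ≤ approxNum (n k - n k / 2) T := by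
      intro k
      apply le_approx (by have := hn1 k; omega)
      intro S j hj hS
      have h1 : RkLE ((c k)⁻¹ • (S - P k)) (j + σ k) := (hS.sub (hPrk k)).smul _
      have h2 := hUlow k _ (j + σ k) (by have := hσ k; omega) h1
      have h3 : c k • (U k - (c k)⁻¹ • (S - P k)) = (T - S) - (T - P (k + 1)) := by
        have : P (k + 1) = P k + c k • U k := Finset.sum_range_succ _ _
        rw [this, smul_sub, smul_smul, mul_inv_cancel₀ (hcpos k).ne', one_smul]
        abel
      have h4 : c k * ‖U k - (c k)⁻¹ • (S - P k)‖ ≤ ‖T - S‖ + ‖T - P (k + 1)‖ := by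
        have := norm_sub_le (T - S) (T - P (k + 1))
        rwa [← h3, norm_smul, Real.norm_eq_abs, abs_of_pos (hcpos k)] at this
      have h5 : c k * (n k : ℝ) ^ (-δ) ≤ c k * ‖U k - (c k)⁻¹ • (S - P k)‖ :=
        mul_le_mul_of_nonneg_left h2 (hcpos k).le
      have h6 := htail (k + 1)
      have h7 := hc4 k
      have h8 : (n k : ℝ) ^ (-(s + δ)) = c k * (n k : ℝ) ^ (-δ) := by
        rw [neg_add, Real.rpow_add (hnpos k)]
      rw [h8]
      linarith
    have hbd : ∀ k, (n k : ℝ) ^ δ ≤ 2 * |C| * (2 : ℝ) ^ (s + 2 * δ) := by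
      intro k
      have h1 := hlow k
      have hk1 := hn1 k
      have h2 := hC (n k - n k / 2 - 1)
      rw [show n k - n k / 2 - 1 + 1 = n k - n k / 2 by omega] at h2
      have h3 : (n k : ℝ) / 2 ≤ ((n k - n k / 2 - 1 : ℕ) : ℝ) + 1 := by
        have : n k ≤ 2 * (n k - n k / 2 - 1 + 1) := by omega
        have : (n k : ℝ) ≤ 2 * (((n k - n k / 2 - 1 : ℕ) : ℝ) + 1) := by exact_mod_cast this
        linarith
      have hp := hnpos k
      have h4 : (((n k - n k / 2 - 1 : ℕ) : ℝ) + 1) ^ (-(s + 2 * δ)) ≤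
          ((n k : ℝ) / 2) ^ (-(s + 2 * δ)) :=
        Real.rpow_le_rpow_of_nonpos (by positivity) h3 (by linarith)
      have h5 : (n k : ℝ) ^ (-(s + δ)) / 2 ≤ |C| * ((n k : ℝ) / 2) ^ (-(s + 2 * δ)) := by
        refine (h1.trans h2).trans ?_
        gcongr
        exact le_abs_self C
      rw [Real.div_rpow hp.le (by norm_num), Real.rpow_neg (by norm_num : (0 : ℝ) ≤ 2)] at h5
      have h6 : (n k : ℝ) ^ (-(s + δ)) = (n k : ℝ) ^ (-(s + 2 * δ)) * (n k : ℝ) ^ δ := by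
        rw [← Real.rpow_add hp]; congr 1; ring
      rw [h6, div_inv_eq_mul] at h5
      have h7 : 0 < (n k : ℝ) ^ (-(s + 2 * δ)) := by positivity
      refine le_of_mul_le_mul_left ?_ h7
      linarith
    have ht : Filter.Tendsto (fun k : ℕ => (k : ℝ) ^ δ) Filter.atTop Filter.atTop :=
      (tendsto_rpow_atTop hδ).comp tendsto_natCast_atTop_atTop
    obtain ⟨k, hk⟩ := (ht.eventually_gt_atTop (2 * |C| * (2 : ℝ) ^ (s + 2 * δ))).exists
    have h1 : (k : ℝ) ^ δ ≤ (n k : ℝ) ^ δ := by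
      have : (k : ℝ) ≤ n k := by exact_mod_cast (hngrow k).le
      gcongr
    linarith [hbd k]
end

theorem stmt_13 {X Y : Type*} [NormedAddCommGroup X] [NormedSpace ℝ X] [CompleteSpace X]
    [NormedAddCommGroup Y] [NormedSpace ℝ Y] [CompleteSpace Y]
    (hX : ¬ FiniteDimensional ℝ X) (hY : ¬ FiniteDimensional ℝ Y)
    (p q r e : ℝ) (hp : 0 < p) (hq : 0 < q) (hr : 0 < r) (he : 0 < e) :
    {T : X →L[ℝ] Y | MemLorentz p (r + e) (fun n => approxNum (n + 1) T)}
      ⊂ {T : X →L[ℝ] Y | MemLorentz q r (fun n => approxNum (n + 1) T)} := by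
  rw [ssubset_iff_subset_not_subset]
  constructor
  · intro T hT
    obtain ⟨C, hC⟩ := lorentz_decay (approx_anti T) (approx_nonneg T) hp (by linarith) hT
    exact decay_lorentz (approx_anti T) (approx_nonneg T) hq (by linarith) hC
  · intro hsub
    obtain ⟨T, ⟨C, hC⟩, hnot⟩ := main_op (X := X) (Y := Y) hX hY (s := r + e / 2) (δ := e / 4)
      (by linarith) (by linarith)
    have hT : MemLorentz q r (fun n => approxNum (n + 1) T) :=
      decay_lorentz (approx_anti T) (approx_nonneg T) hq (by linarith) hC
    have hT2 : MemLorentz p (r + e) (fun n => approxNum (n + 1) T) := hsub hT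
    obtain ⟨C', hC'⟩ := lorentz_decay (approx_anti T) (approx_nonneg T) hp (by linarith) hT2
    refine hnot ⟨C', fun n => ?_⟩
    have h := hC' n
    rwa [show r + e = r + e / 2 + 2 * (e / 4) by ring] at h
end
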